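/- arXiv:1912.03711 — 6 statements merged into one kernel-verified Lean document; each statement's English description precedes it below -/
import Mathlib

section
/- Let f : ℕ → ℂ be an arithmetical function whose Dirichlet series F(s) = Σ_{n≥1} f(n) n^{-s} has abscissa of absolute convergence σ_a. Then for any α > max(0, σ_a), T ≥ 1 and x ≥ 1, one has Σ_{n ≤ x} f(n) = (1/(2πi)) ∫_{α−iT}^{α+iT} F(s) x^s / s ds + O( x^α Σ_{n≥1} |f(n)| / ( n^α (1 + T |log(x/n)|) ) ), with an absolute implied constant. -/
namespace PerronFormula

open Complex

/-- The truncated Perron integral `∫ t in -T..T, e^{sL} / s` on the vertical segment `s = a + it`. -/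
noncomputable def perronVertical (T L a : ℝ) : ℂ :=
  ∫ t in (-T)..T, exp (((a : ℂ) + t * I) * L) / ((a : ℂ) + t * I)

/-- The integral of `e^{sL} / s` on the horizontal segment from `a + iτ` to `b + iτ`. -/
noncomputable def perronHorizontal (L a b τ : ℝ) : ℂ :=
  ∫ x in a..b, exp (((x : ℂ) + τ * I) * L) / ((x : ℂ) + τ * I)

theorem ofReal_add_mul_I_ne_zero_of_re {a : ℝ} (ha : a ≠ 0) (t : ℝ) : (a : ℂ) + t * I ≠ 0 :=
  fun h => ha (by simpa using congrArg re h)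

theorem ofReal_add_mul_I_ne_zero_of_im {t : ℝ} (ht : t ≠ 0) (a : ℝ) : (a : ℂ) + t * I ≠ 0 :=
  fun h => ht (by simpa using congrArg im h)

theorem abs_le_norm_ofReal_add_mul_I_left (a t : ℝ) : |a| ≤ ‖(a : ℂ) + t * I‖ := by
  simpa using abs_re_le_norm ((a : ℂ) + t * I)

theorem abs_le_norm_ofReal_add_mul_I_right (a t : ℝ) : |t| ≤ ‖(a : ℂ) + t * I‖ := by
  simpa using abs_im_le_norm ((a : ℂ) + t * I)

theorem norm_exp_ofReal_add_mul_I_mul (a t L : ℝ) :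
    ‖exp (((a : ℂ) + t * I) * L)‖ = Real.exp (a * L) := by
  simp [norm_exp]

theorem continuous_perronVertical_integrand {a : ℝ} (ha : a ≠ 0) (L : ℝ) :
    Continuous fun t : ℝ => exp (((a : ℂ) + t * I) * L) / ((a : ℂ) + t * I) :=
  Continuous.div (by fun_prop) (by fun_prop) (ofReal_add_mul_I_ne_zero_of_re ha)

theorem continuous_perronHorizontal_integrand {τ : ℝ} (hτ : τ ≠ 0) (L : ℝ) :
    Continuous fun x : ℝ => exp (((x : ℂ) + τ * I) * L) / ((x : ℂ) + τ * I) :=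
  Continuous.div (by fun_prop) (by fun_prop) (ofReal_add_mul_I_ne_zero_of_im hτ)

theorem norm_perronVertical_le {a : ℝ} (ha : a ≠ 0) {T : ℝ} (hT : 0 < T) (L : ℝ) :
    ‖perronVertical T L a‖ ≤ Real.exp (a * L) / |a| * (2 * T) := by
  have h := intervalIntegral.norm_integral_le_of_norm_le_const (a := -T) (b := T)
    (C := Real.exp (a * L) / |a|)
    (f := fun t : ℝ => exp (((a : ℂ) + t * I) * L) / ((a : ℂ) + t * I)) fun t _ => by
      rw [norm_div, norm_exp_ofReal_add_mul_I_mul]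
      gcongr
      exact abs_le_norm_ofReal_add_mul_I_left a t
  rwa [show |T - -T| = 2 * T by rw [abs_of_pos] <;> linarith] at h

theorem norm_perronHorizontal_le {a b : ℝ} (hab : a ≤ b) {τ L : ℝ} (hτ : τ ≠ 0) (hL : L ≠ 0) :
    ‖perronHorizontal L a b τ‖ ≤ (Real.exp (b * L) - Real.exp (a * L)) / L / |τ| := by
  have hcont : Continuous fun x : ℝ => Real.exp (x * L) / |τ| := by fun_prop
  have h := intervalIntegral.norm_integral_le_of_norm_le (μ := MeasureTheory.volume) hab
    (f := fun x : ℝ => exp (((x : ℂ) + τ * I) * L) / ((x : ℂ) + τ * I))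
    (g := fun x => Real.exp (x * L) / |τ|) (.of_forall fun x _ => by
      rw [norm_div, norm_exp_ofReal_add_mul_I_mul]
      gcongr
      exact abs_le_norm_ofReal_add_mul_I_right x τ) (hcont.intervalIntegrable _ _)
  refine h.trans_eq ?_
  rw [intervalIntegral.integral_div, intervalIntegral.integral_comp_mul_right Real.exp hL,
    integral_exp, smul_eq_mul]
  ring

theorem perronVertical_sub_zero {a : ℝ} (ha : a ≠ 0) (T L : ℝ) :
    perronVertical T L a - perronVertical T 0 a =
      ∫ t in (-T)..T, dslope (fun s : ℂ => exp (s * L)) 0 ((a : ℂ) + t * I) := by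
  rw [perronVertical, perronVertical, ← intervalIntegral.integral_sub
    ((continuous_perronVertical_integrand ha L).intervalIntegrable _ _)
    ((continuous_perronVertical_integrand ha 0).intervalIntegrable _ _)]
  refine intervalIntegral.integral_congr fun t _ => ?_
  rw [dslope_of_ne _ (ofReal_add_mul_I_ne_zero_of_re ha t), slope_def_field]
  simp [sub_div]

theorem perronHorizontal_sub_zero {τ : ℝ} (hτ : τ ≠ 0) (L a b : ℝ) :
    perronHorizontal L a b τ - perronHorizontal 0 a b τ =
      ∫ x in a..b, dslope (fun s : ℂ => exp (s * L)) 0 ((x : ℂ) + τ * I) := by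
  rw [perronHorizontal, perronHorizontal, ← intervalIntegral.integral_sub
    ((continuous_perronHorizontal_integrand hτ L).intervalIntegrable _ _)
    ((continuous_perronHorizontal_integrand hτ 0).intervalIntegrable _ _)]
  refine intervalIntegral.integral_congr fun x _ => ?_
  rw [dslope_of_ne _ (ofReal_add_mul_I_ne_zero_of_im hτ x), slope_def_field]
  simp [sub_div]

/-- The integral of `e^{sL} / s` around a rectangle does not depend on `L`. -/
theorem perron_rectangle_eq {a b T : ℝ} (ha : a ≠ 0) (hb : b ≠ 0) (hT : T ≠ 0) (L : ℝ) :
    perronHorizontal L a b (-T) - perronHorizontal L a b T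
        + I * perronVertical T L b - I * perronVertical T L a =
      perronHorizontal 0 a b (-T) - perronHorizontal 0 a b T
        + I * perronVertical T 0 b - I * perronVertical T 0 a := by
  have hd : DifferentiableOn ℂ (dslope (fun s : ℂ => exp (s * L)) 0) Set.univ :=
    (differentiableOn_dslope Filter.univ_mem).2 (by fun_prop)
  have h := integral_boundary_rect_eq_zero_of_differentiableOn _ ⟨a, -T⟩ ⟨b, T⟩
    (hd.mono (Set.subset_univ _))
  simp only [smul_eq_mul] at h
  rw [← perronVertical_sub_zero ha, ← perronVertical_sub_zero hb,
    ← perronHorizontal_sub_zero hT, ← perronHorizontal_sub_zero (neg_ne_zero.2 hT)] at h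
  linear_combination h

theorem I_mul_perronVertical_zero {a : ℝ} (ha : 0 < a) (T : ℝ) :
    I * perronVertical T 0 a = log (a + T * I) - log (a - T * I) := by
  have h := intervalIntegral.integral_eq_sub_of_hasDerivAt (a := -T) (b := T)
    (f := fun t : ℝ => log ((a : ℂ) + t * I))
    (f' := fun t : ℝ => I * (exp (((a : ℂ) + t * I) * (0 : ℝ)) / ((a : ℂ) + t * I))) (fun t _ => by
      have h1 : HasDerivAt (fun t : ℝ => (a : ℂ) + t * I) I t := by
        simpa using ((ofRealCLM.hasDerivAt (x := t)).mul_const I).const_add (a : ℂ)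
      have h2 := h1.clog_real (.inl (by simpa using ha))
      simpa [div_eq_mul_inv] using h2)
    ((continuous_const.mul (continuous_perronVertical_integrand ha.ne' 0)).intervalIntegrable _ _)
  rw [intervalIntegral.integral_const_mul] at h
  simpa [perronVertical, sub_eq_add_neg] using h

theorem perronHorizontal_zero {τ : ℝ} (hτ : τ ≠ 0) (a b : ℝ) :
    perronHorizontal 0 a b τ = log (b + τ * I) - log (a + τ * I) := by
  refine intervalIntegral.integral_eq_sub_of_hasDerivAt (f := fun x : ℝ => log ((x : ℂ) + τ * I))
    (fun x _ => ?_) ((continuous_perronHorizontal_integrand hτ 0).intervalIntegrable _ _)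
  have h1 : HasDerivAt (fun x : ℝ => (x : ℂ) + τ * I) 1 x := by
    simpa using (ofRealCLM.hasDerivAt (x := x)).add_const (τ * I : ℂ)
  have h2 := h1.clog_real (.inr (by simpa using hτ))
  simpa using h2

theorem perronVertical_zero_neg (a T : ℝ) :
    perronVertical T 0 (-a) = -perronVertical T 0 a := by
  have h := intervalIntegral.integral_comp_neg (a := -T) (b := T)
    (fun t : ℝ => exp (((-a : ℝ) + t * I) * (0 : ℝ)) / (((-a : ℝ) : ℂ) + t * I))
  rw [neg_neg] at h
  rw [perronVertical, ← h, perronVertical, ← intervalIntegral.integral_neg]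
  refine intervalIntegral.integral_congr fun t _ => ?_
  simp only [ofReal_zero, mul_zero, exp_zero, ofReal_neg]
  rw [← div_neg]
  ring_nf

theorem perron_rectangle_pos {a b T : ℝ} (ha : 0 < a) (hb : 0 < b) (hT : 0 < T) (L : ℝ) :
    perronHorizontal L a b (-T) - perronHorizontal L a b T
        + I * perronVertical T L b - I * perronVertical T L a = 0 := by
  rw [perron_rectangle_eq ha.ne' hb.ne' hT.ne', perronHorizontal_zero hT.ne',
    perronHorizontal_zero (neg_ne_zero.2 hT.ne'), I_mul_perronVertical_zero ha,
    I_mul_perronVertical_zero hb, ofReal_neg, neg_mul, ← sub_eq_add_neg, ← sub_eq_add_neg]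
  ring

theorem log_neg_of_im_pos {z : ℂ} (hz : 0 < z.im) : log (-z) = log z - Real.pi * I := by
  rw [log, log, norm_neg, arg_neg_eq_arg_sub_pi_of_im_pos hz]
  push_cast
  ring

theorem perron_rectangle_neg {a b T : ℝ} (ha : 0 < a) (hb : 0 < b) (hT : 0 < T) (L : ℝ) :
    perronHorizontal L (-a) b (-T) - perronHorizontal L (-a) b T
        + I * perronVertical T L b - I * perronVertical T L (-a) = 2 * Real.pi * I := by
  have h1 := log_neg_of_im_pos (z := ((-a : ℝ) : ℂ) + T * I) (by simpa using hT)
  have h2 := log_neg_of_im_pos (z := (a : ℂ) + T * I) (by simpa using hT)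
  have e1 : -(((-a : ℝ) : ℂ) + T * I) = a - T * I := by push_cast; ring
  have e2 : -((a : ℂ) + T * I) = ((-a : ℝ) : ℂ) - T * I := by push_cast; ring
  rw [e1] at h1
  rw [e2] at h2
  rw [perron_rectangle_eq (neg_ne_zero.2 ha.ne') hb.ne' hT.ne', perronVertical_zero_neg,
    perronHorizontal_zero hT.ne', perronHorizontal_zero (neg_ne_zero.2 hT.ne'), mul_neg,
    I_mul_perronVertical_zero ha, I_mul_perronVertical_zero hb, ofReal_neg T, neg_mul,
    ← sub_eq_add_neg, ← sub_eq_add_neg, h1, h2]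
  ring

theorem norm_perronVertical_le_of_neg {α T L : ℝ} (hα : 0 < α) (hT : 0 < T) (hL : L < 0) :
    ‖perronVertical T L α‖ ≤ 2 * Real.exp (α * L) / (T * |L|) := by
  have hlim : Filter.Tendsto (fun R : ℝ => 2 * Real.exp (α * L) / (T * |L|) + 2 * T / R)
      Filter.atTop (nhds (2 * Real.exp (α * L) / (T * |L|) + 0)) :=
    tendsto_const_nhds.add (tendsto_const_nhds.div_atTop Filter.tendsto_id)
  rw [add_zero] at hlim
  refine ge_of_tendsto hlim ?_
  filter_upwards [Filter.eventually_ge_atTop α] with R hR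
  have hR0 : 0 < R := hα.trans_le hR
  have hH : ∀ τ : ℝ, |τ| = T →
      ‖perronHorizontal L α R τ‖ ≤ Real.exp (α * L) / (T * |L|) := fun τ hτ => by
    refine (norm_perronHorizontal_le hR (abs_pos.1 (hτ ▸ hT)) hL.ne).trans ?_
    rw [hτ, div_div, mul_comm L T, abs_of_neg hL, ← neg_div_neg_eq, ← mul_neg]
    gcongr
    · nlinarith
    · linarith [Real.exp_pos (R * L)]
  have hV : ‖perronVertical T L R‖ ≤ 2 * T / R := by
    refine (norm_perronVertical_le hR0.ne' hT L).trans ?_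
    rw [abs_of_pos hR0, div_mul_eq_mul_div]
    refine div_le_div_of_nonneg_right ?_ hR0.le
    have : Real.exp (R * L) ≤ 1 := Real.exp_le_one_iff.2 (by nlinarith)
    nlinarith
  have key := perron_rectangle_pos hα hR0 hT L
  have e : I * perronVertical T L α = perronHorizontal L α R (-T) - perronHorizontal L α R T
      + I * perronVertical T L R := by linear_combination -key
  have h := (norm_add_le _ _).trans
    (add_le_add_left (norm_sub_le _ _) _) |>.trans' (congrArg norm e).le
  simp only [norm_mul, norm_I, one_mul] at h
  have h1 := hH (-T) (by rw [abs_neg, abs_of_pos hT])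
  have h2 := hH T (abs_of_pos hT)
  rw [mul_div_assoc]
  linarith

theorem norm_two_pi_sub_perronVertical_le_of_pos {α T L : ℝ} (hα : 0 < α) (hT : 0 < T)
    (hL : 0 < L) :
    ‖2 * Real.pi - perronVertical T L α‖ ≤ 2 * Real.exp (α * L) / (T * |L|) := by
  have hlim : Filter.Tendsto (fun R : ℝ => 2 * Real.exp (α * L) / (T * |L|) + 2 * T / R)
      Filter.atTop (nhds (2 * Real.exp (α * L) / (T * |L|) + 0)) :=
    tendsto_const_nhds.add (tendsto_const_nhds.div_atTop Filter.tendsto_id)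
  rw [add_zero] at hlim
  refine ge_of_tendsto hlim ?_
  filter_upwards [Filter.eventually_gt_atTop 0] with R hR0
  have hH : ∀ τ : ℝ, |τ| = T →
      ‖perronHorizontal L (-R) α τ‖ ≤ Real.exp (α * L) / (T * |L|) := fun τ hτ => by
    refine (norm_perronHorizontal_le (by linarith) (abs_pos.1 (hτ ▸ hT)) hL.ne').trans ?_
    rw [hτ, div_div, mul_comm L T, abs_of_pos hL]
    gcongr
    linarith [Real.exp_pos (-R * L)]
  have hV : ‖perronVertical T L (-R)‖ ≤ 2 * T / R := by
    refine (norm_perronVertical_le (neg_ne_zero.2 hR0.ne') hT L).trans ?_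
    rw [abs_neg, abs_of_pos hR0, div_mul_eq_mul_div]
    refine div_le_div_of_nonneg_right ?_ hR0.le
    have : Real.exp (-R * L) ≤ 1 := Real.exp_le_one_iff.2 (by nlinarith)
    nlinarith
  have key := perron_rectangle_neg hR0 hα hT L
  have e : I * (2 * Real.pi - perronVertical T L α) =
      perronHorizontal L (-R) α (-T) - perronHorizontal L (-R) α T
        - I * perronVertical T L (-R) := by linear_combination -key
  have h := (norm_sub_le _ _).trans
    (add_le_add_left (norm_sub_le _ _) _) |>.trans' (congrArg norm e).le
  simp only [norm_mul, norm_I, one_mul] at h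
  have h1 := hH (-T) (by rw [abs_neg, abs_of_pos hT])
  have h2 := hH T (abs_of_pos hT)
  rw [mul_div_assoc]
  linarith

theorem norm_perronVertical_zero_le {α : ℝ} (hα : 0 < α) (T : ℝ) :
    ‖perronVertical T 0 α‖ ≤ 2 * Real.pi := by
  have hn : ‖(α : ℂ) - T * I‖ = ‖(α : ℂ) + T * I‖ := by
    rw [← norm_conj]; simp
  have h : I * perronVertical T 0 α = ((arg (α + T * I) - arg (α - T * I) : ℝ) : ℂ) * I := by
    rw [I_mul_perronVertical_zero hα, log, log, hn]
    push_cast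
    ring
  have h' := congrArg norm h
  simp only [norm_mul, norm_I, one_mul, mul_one, norm_real, Real.norm_eq_abs] at h'
  rw [h']
  exact (abs_sub _ _).trans (by linarith [abs_arg_le_pi (α + T * I), abs_arg_le_pi (α - T * I)])

theorem norm_perronVertical_le_of_abs_le {α T L : ℝ} (hα : 0 < α) (hT : 0 < T)
    (hL : T * |L| ≤ 1) :
    ‖perronVertical T L α‖ ≤ Real.exp (α * L) * (2 * Real.pi + 2) := by
  have hint := fun L => (continuous_perronVertical_integrand hα.ne' L).intervalIntegrable
    (μ := MeasureTheory.volume) (-T) T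
  have e : perronVertical T L α - Real.exp (α * L) * perronVertical T 0 α =
      ∫ t in (-T)..T, Real.exp (α * L) * ((exp (I * (t * L : ℝ)) - 1) / (α + t * I)) := by
    rw [perronVertical, perronVertical, ← intervalIntegral.integral_const_mul,
      ← intervalIntegral.integral_sub (hint L) ((hint 0).const_mul _)]
    refine intervalIntegral.integral_congr fun t _ => ?_
    simp only [ofReal_zero, mul_zero, exp_zero]
    rw [show ((α : ℂ) + t * I) * L = (α * L : ℝ) + I * (t * L : ℝ) by push_cast; ring, exp_add,
      ofReal_exp]
    ring
  have h := intervalIntegral.norm_integral_le_of_norm_le_const (a := -T) (b := T)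
    (C := Real.exp (α * L) * |L|)
    (f := fun t : ℝ => Real.exp (α * L) * ((exp (I * (t * L : ℝ)) - 1) / (α + t * I)))
    fun t _ => by
      rw [norm_mul, norm_real, Real.norm_of_nonneg (Real.exp_pos _).le, norm_div]
      gcongr
      rw [div_le_iff₀ (norm_pos_iff.2 (ofReal_add_mul_I_ne_zero_of_re hα.ne' t))]
      refine Real.norm_exp_I_mul_ofReal_sub_one_le.trans ?_
      rw [Real.norm_eq_abs, abs_mul, mul_comm]
      gcongr
      exact abs_le_norm_ofReal_add_mul_I_right α t
  rw [← e, show |T - -T| = 2 * T by rw [abs_of_pos] <;> linarith] at h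
  have h0 : ‖(Real.exp (α * L) : ℂ) * perronVertical T 0 α‖ ≤ Real.exp (α * L) * (2 * Real.pi) := by
    rw [norm_mul, norm_real, Real.norm_of_nonneg (Real.exp_pos _).le]
    gcongr
    exact norm_perronVertical_zero_le hα T
  have h3 := norm_le_norm_sub_add (perronVertical T L α)
    ((Real.exp (α * L) : ℂ) * perronVertical T 0 α)
  nlinarith [Real.exp_pos (α * L)]

/-- The truncated Perron integral approximates `2π` times the indicator of `0 ≤ L`. -/
theorem norm_two_pi_indicator_sub_perronVertical_le {α T : ℝ} (hα : 0 < α) (hT : 0 < T) (L : ℝ) :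
    ‖(if 0 ≤ L then 2 * Real.pi else 0 : ℂ) - perronVertical T L α‖ ≤
      (8 * Real.pi + 4) * (Real.exp (α * L) / (1 + T * |L|)) := by
  have hE := Real.exp_pos (α * L)
  have hp := Real.pi_pos
  have hTL : 0 ≤ T * |L| := by positivity
  rw [← mul_div_assoc, le_div_iff₀ (by positivity)]
  rcases le_total (T * |L|) 1 with h | h
  · have h1 : ‖(if 0 ≤ L then 2 * Real.pi else 0 : ℂ)‖ ≤ Real.exp (α * L) * (2 * Real.pi) := by
      split_ifs with hL
      · have : 1 ≤ Real.exp (α * L) := Real.one_le_exp (by positivity)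
        simp only [norm_mul, norm_real, Real.norm_of_nonneg hp.le, RCLike.norm_ofNat]
        nlinarith
      · simp only [norm_zero]; positivity
    have h2 := (norm_sub_le (if 0 ≤ L then 2 * Real.pi else 0 : ℂ) (perronVertical T L α)).trans
      (add_le_add h1 (norm_perronVertical_le_of_abs_le hα hT h))
    calc _ ≤ (Real.exp (α * L) * (2 * Real.pi) + Real.exp (α * L) * (2 * Real.pi + 2)) *
          (1 + 1) := by gcongr
      _ = _ := by ring
  · have h1 : ‖(if 0 ≤ L then 2 * Real.pi else 0 : ℂ) - perronVertical T L α‖ ≤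
        2 * Real.exp (α * L) / (T * |L|) := by
      rcases lt_trichotomy L 0 with hL | rfl | hL
      · rw [if_neg hL.not_ge, zero_sub, norm_neg]
        exact norm_perronVertical_le_of_neg hα hT hL
      · norm_num at h
      · rw [if_pos hL.le]
        exact norm_two_pi_sub_perronVertical_le_of_pos hα hT hL
    rw [le_div_iff₀ (by linarith)] at h1
    nlinarith [norm_nonneg ((if 0 ≤ L then 2 * Real.pi else 0 : ℂ) - perronVertical T L α)]

theorem term_mul_cpow_div {f : ℕ → ℂ} {x : ℝ} (hx : 0 < x) {n : ℕ} (hn : n ≠ 0) (s : ℂ) :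
    LSeries.term f s n * (x : ℂ) ^ s / s * I =
      I * f n * (exp (s * Real.log (x / n)) / s) := by
  have hn' : (n : ℂ) ≠ 0 := Nat.cast_ne_zero.2 hn
  rw [LSeries.term_of_ne_zero hn, cpow_def_of_ne_zero (ofReal_ne_zero.2 hx.ne'),
    cpow_def_of_ne_zero hn', Real.log_div hx.ne' (Nat.cast_ne_zero.2 hn), ofReal_sub,
    ofReal_log hx.le, ofReal_log n.cast_nonneg, ofReal_natCast, mul_sub, exp_sub,
    mul_comm s, mul_comm s]
  ring

theorem hasSum_perronVertical {f : ℕ → ℂ} {α x : ℝ} (hα : 0 < α) (hf : LSeriesSummable f α)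
    (hx : 0 < x) (T : ℝ) :
    HasSum (fun n : ℕ => if n = 0 then 0 else I * f n * perronVertical T (Real.log (x / n)) α)
      (∫ t in (-T)..T, LSeries f ((α : ℂ) + t * I) * (x : ℂ) ^ ((α : ℂ) + t * I) /
        ((α : ℂ) + t * I) * I) := by
  have key := intervalIntegral.hasSum_integral_of_dominated_convergence
    (μ := MeasureTheory.volume) (a := -T) (b := T)
    (F := fun (n : ℕ) (t : ℝ) => LSeries.term f ((α : ℂ) + t * I) n *
      (x : ℂ) ^ ((α : ℂ) + t * I) / ((α : ℂ) + t * I) * I)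
    (f := fun t : ℝ => LSeries f ((α : ℂ) + t * I) *
      (x : ℂ) ^ ((α : ℂ) + t * I) / ((α : ℂ) + t * I) * I)
    (fun n _ => ‖LSeries.term f α n‖ * (x ^ α / α))
    (fun n => ?_) (fun n => .of_forall fun t _ => ?_)
    (.of_forall fun t _ => (hf.norm.mul_right _)) intervalIntegrable_const
    (.of_forall fun t _ => ?_)
  · refine Eq.mp (congrArg (HasSum · _) (funext fun n => ?_)) key
    split_ifs with hn
    · simp [hn]
    · rw [perronVertical, ← intervalIntegral.integral_const_mul]
      exact intervalIntegral.integral_congr fun t _ => term_mul_cpow_div hx hn _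
  · refine Continuous.aestronglyMeasurable ?_
    rcases eq_or_ne n 0 with rfl | hn
    · simpa using continuous_const
    · simp only [term_mul_cpow_div hx hn]
      exact continuous_const.mul (continuous_perronVertical_integrand hα.ne' _)
  · rw [norm_mul, norm_I, mul_one, mul_div_assoc, norm_mul, norm_div,
      norm_cpow_eq_rpow_re_of_pos hx, LSeries.norm_term_eq, LSeries.norm_term_eq]
    have hre : ((α : ℂ) + t * I).re = α := by simp
    rw [hre, ofReal_re]
    gcongr
    exact (le_abs_self α).trans (abs_le_norm_ofReal_add_mul_I_left α t)
  · have hs : LSeriesSummable f ((α : ℂ) + t * I) := hf.of_re_le_re (by simp)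
    simp only [mul_div_assoc, mul_assoc]
    exact hs.hasSum.mul_right _

theorem hasSum_ite_zero_le_log (f : ℕ → ℂ) {x : ℝ} (hx : 0 < x) :
    HasSum (fun n : ℕ => if n = 0 then 0 else if 0 ≤ Real.log (x / n) then f n else 0)
      (∑ n ∈ Finset.Icc 1 ⌊x⌋₊, f n) := by
  have hiff : ∀ n : ℕ, n ≠ 0 → (0 ≤ Real.log (x / n) ↔ n ∈ Finset.Icc 1 ⌊x⌋₊) := fun n hn => by
    have hn' : (0 : ℝ) < n := Nat.cast_pos.2 hn.bot_lt
    rw [Real.log_nonneg_iff (by positivity), one_le_div hn', Finset.mem_Icc,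
      Nat.le_floor_iff hx.le]
    exact ⟨fun h => ⟨Nat.one_le_iff_ne_zero.2 hn, h⟩, And.right⟩
  rw [Finset.sum_congr rfl (g := fun n : ℕ =>
    if n = 0 then 0 else if 0 ≤ Real.log (x / n) then f n else 0)]
  · refine hasSum_sum_of_ne_finset_zero fun n hn => ?_
    split_ifs with h0 h1
    · rfl
    · exact absurd ((hiff n h0).1 h1) hn
    · rfl
  · intro n hn
    have h0 : n ≠ 0 := Nat.one_le_iff_ne_zero.1 (Finset.mem_Icc.1 hn).1
    rw [if_neg h0, if_pos ((hiff n h0).2 hn)]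

theorem summable_perron_error {f : ℕ → ℂ} {α T : ℝ} (hα : α ≠ 0) (hT : 0 ≤ T)
    (hf : LSeriesSummable f α) (x : ℝ) :
    Summable fun n : ℕ => ‖f n‖ / ((n : ℝ) ^ α * (1 + T * |Real.log (x / (n : ℝ))|)) := by
  refine Summable.of_nonneg_of_le (fun n => by positivity) (fun n => ?_) hf.norm
  rw [LSeries.norm_term_eq, ofReal_re]
  split_ifs with hn
  · simp [hn, Real.zero_rpow hα]
  · have hn' : (0 : ℝ) < n := Nat.cast_pos.2 (Nat.pos_of_ne_zero hn)
    gcongr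
    have : 0 ≤ T * |Real.log (x / n)| := by positivity
    exact le_mul_of_one_le_right (by positivity) (by linarith)

end PerronFormula

open PerronFormula in
/-- quantitative Perron formula. There is an absolute constant `C` such that
for any arithmetical function `f` with Dirichlet series `F(s) = Σ f(n) n^{-s}` of abscissa of
absolute convergence `σ_a`, any `α > max(0, σ_a)`, `T ≥ 1` and `x ≥ 1`,
`Σ_{n ≤ x} f(n) = (1/(2πi)) ∫_{α-iT}^{α+iT} F(s) x^s/s ds
  + O(x^α Σ_{n ≥ 1} |f(n)| / (n^α (1 + T|log(x/n)|)))`. -/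
theorem perron_formula :
    ∃ C : ℝ, 0 < C ∧ ∀ (f : ℕ → ℂ) (α T x : ℝ),
      max 0 (LSeries.abscissaOfAbsConv f) < (α : EReal) → 1 ≤ T → 1 ≤ x →
      ‖(∑ n ∈ Finset.Icc 1 ⌊x⌋₊, f n) -
          (2 * Real.pi * Complex.I)⁻¹ *
            ∫ t in (-T)..T,
              LSeries f ((α : ℂ) + t * Complex.I) *
                (x : ℂ) ^ ((α : ℂ) + t * Complex.I) / ((α : ℂ) + t * Complex.I) * Complex.I‖
        ≤ C * (x ^ α *
            ∑' n : ℕ, ‖f n‖ / ((n : ℝ) ^ α * (1 + T * |Real.log (x / (n : ℝ))|))) := by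
  refine ⟨(2 * Real.pi)⁻¹ * (8 * Real.pi + 4), by positivity, fun f α T x hσ hT hx => ?_⟩
  have hα : 0 < α := by exact_mod_cast (le_max_left _ _).trans_lt hσ
  have hT0 : 0 < T := by linarith
  have hx0 : 0 < x := by linarith
  have hf : LSeriesSummable f α :=
    LSeriesSummable_of_abscissaOfAbsConv_lt_re ((le_max_right _ _).trans_lt hσ)
  have hsum := (hasSum_ite_zero_le_log f hx0).sub
    ((hasSum_perronVertical hα hf hx0 T).mul_left (2 * Real.pi * Complex.I)⁻¹)
  rw [← hsum.tsum_eq, ← mul_assoc]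
  refine tsum_of_norm_bounded ((summable_perron_error hα.ne' hT0.le hf x).hasSum.mul_left _)
    fun n => ?_
  rcases eq_or_ne n 0 with rfl | hn
  · simp [Real.zero_rpow hα.ne']
  have hn' : (0 : ℝ) < n := Nat.cast_pos.2 (Nat.pos_of_ne_zero hn)
  have hpi : (Real.pi : ℂ) ≠ 0 := Complex.ofReal_ne_zero.2 Real.pi_ne_zero
  have hfactor : (if 0 ≤ Real.log (x / n) then f n else 0) - (2 * Real.pi * Complex.I)⁻¹ *
      (Complex.I * f n * perronVertical T (Real.log (x / n)) α) =
      (((2 * Real.pi)⁻¹ : ℝ) : ℂ) * (f n * ((if 0 ≤ Real.log (x / n) then 2 * Real.pi else 0 : ℂ)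
        - perronVertical T (Real.log (x / n)) α)) := by
    push_cast
    split_ifs
    · field_simp [Complex.I_ne_zero]
    · field_simp [Complex.I_ne_zero]
      ring
  have hexp : Real.exp (α * Real.log (x / n)) = x ^ α / (n : ℝ) ^ α := by
    rw [← Real.div_rpow hx0.le hn'.le, Real.rpow_def_of_pos (by positivity), mul_comm]
  have hker := norm_two_pi_indicator_sub_perronVertical_le hα hT0 (Real.log (x / n))
  rw [if_neg hn, if_neg hn, hfactor, norm_mul, norm_mul, Complex.norm_real,
    Real.norm_of_nonneg (by positivity)]
  rw [hexp] at hker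
  calc _ ≤ (2 * Real.pi)⁻¹ * (‖f n‖ * ((8 * Real.pi + 4) *
        (x ^ α / (n : ℝ) ^ α / (1 + T * |Real.log (x / n)|)))) := by gcongr
    _ = _ := by
      rw [div_div]
      ring
end

section
/- Let k and ε be fixed positive real numbers. Let x be large, and suppose x^ε ≤ z ≤ x and q ≤ z^{1−ε}. Then uniformly for all f ∈ C_k and any residue class a (mod q) with gcd(a, q) = 1, one has Σ_{x−z ≤ n ≤ x, n ≡ a (mod q)} |f(n)| ≪_{k,ε} (z/φ(q)) · (1/log x) · exp( Σ_{p ≤ x, p ∤ q} |f(p)|/p ), where the sum in the exponential runs over primes p ≤ x not dividing q and φ is Euler's totient function. -/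
/-- The "logarithmic" coefficients `Λ_f(n)/log n` of the series for `log F`. -/
noncomputable def logCoeff (Λf : ℕ → ℂ) : ℕ → ℂ := fun n => Λf n / (Real.log n : ℂ)

/-- `f : ℕ → ℂ` is multiplicative. -/
def IsMultiplicativeFun (f : ℕ → ℂ) : Prop :=
  f 1 = 1 ∧ ∀ m n : ℕ, Nat.Coprime m n → f (m * n) = f m * f n

/-- Membership in the class `C_k` with a prescribed witness `Λ_f`:  `f` is multiplicative,
`|Λ_f(n)| ≤ k Λ(n)`, the three Dirichlet series `F(s) = Σ f(n) n^{-s}`,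
`Σ Λ_f(n)/((log n) n^s)` and `Σ Λ_f(n) n^{-s}` converge absolutely for `Re s > 1`,
and there they represent `F`, `log F` and `-F'/F` respectively. -/
def MemCkWith (k : ℝ) (f Λf : ℕ → ℂ) : Prop :=
  IsMultiplicativeFun f ∧
  (∀ n : ℕ, ‖Λf n‖ ≤ k * ArithmeticFunction.vonMangoldt n) ∧
  (∀ s : ℂ, 1 < s.re → Summable fun n : ℕ => ‖LSeries.term f s n‖) ∧
  (∀ s : ℂ, 1 < s.re → Summable fun n : ℕ => ‖LSeries.term (logCoeff Λf) s n‖) ∧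
  (∀ s : ℂ, 1 < s.re → Summable fun n : ℕ => ‖LSeries.term Λf s n‖) ∧
  (∀ s : ℂ, 1 < s.re → LSeries f s = Complex.exp (LSeries (logCoeff Λf) s)) ∧
  (∀ s : ℂ, 1 < s.re → HasDerivAt (LSeries f) (-(LSeries f s * LSeries Λf s)) s)

/-- The class `C_k` of `k`-bounded multiplicative functions. -/
def MemCk (k : ℝ) (f : ℕ → ℂ) : Prop := ∃ Λf : ℕ → ℂ, MemCkWith k f Λf

namespace Shiu

open Finset

/-! ### The Selberg sieve -/

/-- The Selberg normalising sum at level `D`. -/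
noncomputable def selbergSum (s : BoundingSieve) (D : ℕ) : ℝ :=
  ∑ l ∈ s.prodPrimes.divisors with l ≤ D, s.selbergTerms l

/-- The optimal Selberg weights at level `D`. -/
noncomputable def selbergWeight (s : BoundingSieve) (D d : ℕ) : ℝ :=
  ArithmeticFunction.moebius d * (s.nu d)⁻¹ * (selbergSum s D)⁻¹ *
    ∑ l ∈ s.prodPrimes.divisors with l ≤ D ∧ d ∣ l, s.selbergTerms l

section

variable {s : BoundingSieve} {D : ℕ}

lemma selbergTerms_nonneg_of_mem {l : ℕ} (hl : l ∈ s.prodPrimes.divisors) :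
    0 ≤ s.selbergTerms l :=
  (BoundingSieve.selbergTerms_pos (Nat.dvd_of_mem_divisors hl)).le

lemma selbergSum_pos (hD : 1 ≤ D) : 0 < selbergSum s D := by
  refine sum_pos' (fun l hl => selbergTerms_nonneg_of_mem (mem_filter.1 hl).1)
    ⟨1, by simp [hD, BoundingSieve.prodPrimes_ne_zero], ?_⟩
  exact BoundingSieve.selbergTerms_pos (one_dvd _)

lemma selbergWeight_one (hD : 1 ≤ D) : selbergWeight s D 1 = 1 := by
  have h := (selbergSum_pos (s := s) hD).ne'
  have : ∑ l ∈ s.prodPrimes.divisors with l ≤ D ∧ 1 ∣ l, s.selbergTerms l = selbergSum s D := by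
    simp [selbergSum]
  rw [selbergWeight, this, s.nu_mult.1]
  simp [h]

lemma selbergWeight_eq_zero {d : ℕ} (hd : D < d) : selbergWeight s D d = 0 := by
  have : {l ∈ s.prodPrimes.divisors | l ≤ D ∧ d ∣ l} = (∅ : Finset ℕ) := by
    refine filter_eq_empty_iff.2 fun l hl h => ?_
    have := Nat.le_of_dvd (Nat.pos_of_mem_divisors hl) h.2
    omega
  simp [selbergWeight, this]

lemma abs_selbergWeight_le (hD : 1 ≤ D) (hν : ∀ d, d ∣ s.prodPrimes → (s.nu d)⁻¹ ≤ d)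
    {d : ℕ} (hd : d ∣ s.prodPrimes) : |selbergWeight s D d| ≤ D := by
  rcases lt_or_ge D d with h | h
  · simp [selbergWeight_eq_zero h]
  have hS := selbergSum_pos (s := s) hD
  have hsum : ∑ l ∈ s.prodPrimes.divisors with l ≤ D ∧ d ∣ l, s.selbergTerms l ≤
      selbergSum s D := by
    refine sum_le_sum_of_subset_of_nonneg (fun l hl => ?_) fun l hl _ =>
      selbergTerms_nonneg_of_mem (mem_filter.1 hl).1
    simp only [mem_filter] at hl ⊢
    tauto
  have hnn : 0 ≤ ∑ l ∈ s.prodPrimes.divisors with l ≤ D ∧ d ∣ l, s.selbergTerms l :=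
    sum_nonneg fun l hl => selbergTerms_nonneg_of_mem (mem_filter.1 hl).1
  have hnu : 0 < (s.nu d)⁻¹ := inv_pos.2 (BoundingSieve.nu_pos_of_dvd_prodPrimes hd)
  have hμ : |(ArithmeticFunction.moebius d : ℝ)| ≤ 1 := by
    exact_mod_cast ArithmeticFunction.abs_moebius_le_one
  rw [selbergWeight, abs_mul, abs_mul, abs_mul, abs_of_pos hnu, abs_of_pos (inv_pos.2 hS),
    abs_of_nonneg hnn]
  calc _ ≤ 1 * (d : ℝ) * (selbergSum s D)⁻¹ * selbergSum s D := by
        gcongr; exact hν d hd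
    _ = d := by field_simp
    _ ≤ D := by exact_mod_cast h

lemma sum_moebius_between {l k : ℕ} (hk : Squarefree k) (hl : l ∣ k) :
    ∑ d ∈ k.divisors with l ∣ d, (ArithmeticFunction.moebius d : ℝ) =
      if l = k then (ArithmeticFunction.moebius l : ℝ) else 0 := by
  obtain ⟨t, rfl⟩ := hl
  have hk0 : l * t ≠ 0 := hk.ne_zero
  have hl0 : l ≠ 0 := left_ne_zero_of_mul hk0
  have ht0 : t ≠ 0 := right_ne_zero_of_mul hk0
  have hset : {d ∈ (l * t).divisors | l ∣ d} = t.divisors.image (l * ·) := by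
    ext d
    simp only [mem_filter, Nat.mem_divisors, mem_image]
    constructor
    · rintro ⟨⟨h1, _⟩, c, rfl⟩
      exact ⟨c, ⟨Nat.dvd_of_mul_dvd_mul_left (Nat.pos_of_ne_zero hl0) h1, ht0⟩, rfl⟩
    · rintro ⟨c, ⟨h1, _⟩, rfl⟩
      exact ⟨⟨Nat.mul_dvd_mul_left l h1, hk0⟩, dvd_mul_right _ _⟩
  rw [hset, sum_image (fun a _ b _ h => Nat.eq_of_mul_eq_mul_left (Nat.pos_of_ne_zero hl0) h)]
  have hcop : l.Coprime t := Nat.coprime_of_squarefree_mul hk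
  have : ∀ c ∈ t.divisors, (ArithmeticFunction.moebius (l * c) : ℝ) =
      ArithmeticFunction.moebius l * (ArithmeticFunction.moebius c : ℝ) := by
    intro c hc
    rw [ArithmeticFunction.isMultiplicative_moebius.map_mul_of_coprime
      (hcop.coprime_dvd_right (Nat.dvd_of_mem_divisors hc))]
    push_cast; rfl
  rw [sum_congr rfl this, ← mul_sum]
  have h1 : ∑ c ∈ t.divisors, (ArithmeticFunction.moebius c : ℝ) = if t = 1 then 1 else 0 := by
    have h := ArithmeticFunction.coe_zeta_mul_apply (f := ArithmeticFunction.moebius) (x := t)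
    rw [ArithmeticFunction.coe_zeta_mul_moebius, ArithmeticFunction.one_apply] at h
    exact_mod_cast h.symm
  rw [h1]
  have : l = l * t ↔ t = 1 := by
    constructor
    · intro h; exact Nat.eq_of_mul_eq_mul_left (Nat.pos_of_ne_zero hl0) (by omega)
    · rintro rfl; simp
  simp [this]

lemma sum_nu_mul_selbergWeight {l : ℕ} (hl : l ∈ s.prodPrimes.divisors) :
    ∑ d ∈ s.prodPrimes.divisors, (if l ∣ d then s.nu d * selbergWeight s D d else 0) =
      if l ≤ D then
        (selbergSum s D)⁻¹ * (s.selbergTerms l * ArithmeticFunction.moebius l) else 0 := by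
  have h1 : ∀ d ∈ s.prodPrimes.divisors,
      (if l ∣ d then s.nu d * selbergWeight s D d else 0) =
      ∑ k ∈ s.prodPrimes.divisors with k ≤ D, (selbergSum s D)⁻¹ * (s.selbergTerms k *
        if d ∣ k ∧ l ∣ d then (ArithmeticFunction.moebius d : ℝ) else 0) := by
    intro d hd
    have hnu := BoundingSieve.nu_ne_zero (Nat.dvd_of_mem_divisors hd)
    split_ifs with h
    · rw [selbergWeight, ← mul_sum, ← filter_filter, sum_filter (fun k => d ∣ k)]
      simp only [h, and_true, mul_ite, mul_zero]
      rw [show ∀ a b c e : ℝ, s.nu d * (a * (s.nu d)⁻¹ * c * e) = c * (e * a) by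
        intro a b c e; field_simp, sum_mul]
      · simp only [ite_mul, zero_mul]
      · exact 0
    · simp [h]
  rw [sum_congr rfl h1, sum_comm]
  have h2 : ∀ k ∈ s.prodPrimes.divisors.filter (· ≤ D),
      ∑ d ∈ s.prodPrimes.divisors, (selbergSum s D)⁻¹ * (s.selbergTerms k *
        if d ∣ k ∧ l ∣ d then (ArithmeticFunction.moebius d : ℝ) else 0) =
      if l = k then (selbergSum s D)⁻¹ * (s.selbergTerms k * ArithmeticFunction.moebius l)
        else 0 := by
    intro k hk
    have hkP := Nat.dvd_of_mem_divisors (mem_filter.1 hk).1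
    rw [← mul_sum, ← mul_sum, ← sum_filter, ← filter_filter,
      Nat.divisors_filter_dvd_of_dvd BoundingSieve.prodPrimes_ne_zero hkP]
    by_cases hlk : l ∣ k
    · rw [sum_moebius_between (BoundingSieve.squarefree_of_dvd_prodPrimes hkP) hlk]
      split_ifs <;> simp
    · have : l ≠ k := fun h => hlk (h ▸ dvd_rfl)
      rw [if_neg this, sum_eq_zero]; · simp
      intro d hd
      simp only [mem_filter, Nat.mem_divisors] at hd
      exact absurd (hd.2.trans hd.1.1) hlk
  rw [sum_congr rfl h2, sum_ite_eq]
  simp only [mem_filter, hl, true_and]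

lemma mainSum_selbergWeight (hD : 1 ≤ D) :
    s.mainSum (BoundingSieve.lambdaSquared (selbergWeight s D)) = (selbergSum s D)⁻¹ := by
  rw [BoundingSieve.mainSum_lambdaSquared_eq_sum_mul_sum_sq]
  have hS := (selbergSum_pos (s := s) hD).ne'
  have h : ∀ l ∈ s.prodPrimes.divisors, (s.selbergTerms l)⁻¹ *
        (∑ d ∈ s.prodPrimes.divisors, if l ∣ d then s.nu d * selbergWeight s D d else 0) ^ 2 =
      if l ≤ D then (selbergSum s D)⁻¹ ^ 2 * s.selbergTerms l else 0 := by
    intro l hl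
    rw [sum_nu_mul_selbergWeight hl]
    have hg := (BoundingSieve.selbergTerms_pos (Nat.dvd_of_mem_divisors hl)).ne'
    have hμ : (ArithmeticFunction.moebius l : ℝ) ^ 2 = 1 := by
      exact_mod_cast ArithmeticFunction.moebius_sq_eq_one_of_squarefree
        (BoundingSieve.squarefree_of_mem_divisors_prodPrimes hl)
    split_ifs
    · rw [mul_pow, mul_pow, hμ]; field_simp
    · simp
  rw [sum_congr rfl h, ← sum_filter, ← mul_sum, ← selbergSum]
  field_simp

lemma errSum_selbergWeight_le (hD : 1 ≤ D)
    (hν : ∀ d, d ∣ s.prodPrimes → (s.nu d)⁻¹ ≤ d)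
    (hr : ∀ d, d ∣ s.prodPrimes → |s.rem d| ≤ 1) :
    s.errSum (BoundingSieve.lambdaSquared (selbergWeight s D)) ≤ (D : ℝ) ^ 4 := by
  set P := s.prodPrimes
  have key : ∀ d ∈ P.divisors,
      |BoundingSieve.lambdaSquared (selbergWeight s D) d| * |s.rem d| ≤
      ∑ x ∈ (Icc 1 D) ×ˢ (Icc 1 D), if d = Nat.lcm x.1 x.2 then (D : ℝ) ^ 2 else 0 := by
    intro d hd
    have hdP := Nat.dvd_of_mem_divisors hd
    calc _ ≤ |BoundingSieve.lambdaSquared (selbergWeight s D) d| * 1 := by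
          gcongr; exact hr d hdP
      _ ≤ ∑ x ∈ d.divisors ×ˢ d.divisors, |if d = Nat.lcm x.1 x.2 then
            selbergWeight s D x.1 * selbergWeight s D x.2 else 0| := by
          rw [mul_one, BoundingSieve.lambdaSquared, ← sum_product']
          exact abs_sum_le_sum_abs _ _
      _ = ∑ x ∈ (d.divisors ×ˢ d.divisors) with x.1 ≤ D ∧ x.2 ≤ D, |if d = Nat.lcm x.1 x.2 then
            selbergWeight s D x.1 * selbergWeight s D x.2 else 0| := by
          refine (sum_filter_of_ne fun x _ hx => ?_).symm
          by_contra hcon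
          apply hx
          rw [not_and_or, not_le, not_le] at hcon
          rcases hcon with h | h <;> simp [selbergWeight_eq_zero h]
      _ ≤ ∑ x ∈ (d.divisors ×ˢ d.divisors) with x.1 ≤ D ∧ x.2 ≤ D,
            if d = Nat.lcm x.1 x.2 then (D : ℝ) ^ 2 else 0 := by
          refine sum_le_sum fun x hx => ?_
          simp only [mem_filter, mem_product, Nat.mem_divisors] at hx
          split_ifs
          · rw [abs_mul, sq]
            exact mul_le_mul (abs_selbergWeight_le hD hν (hx.1.1.1.trans hdP))
              (abs_selbergWeight_le hD hν (hx.1.2.1.trans hdP)) (abs_nonneg _) (Nat.cast_nonneg _)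
          · simp
      _ ≤ _ := by
          refine sum_le_sum_of_subset_of_nonneg (fun x hx => ?_) fun x _ _ => by positivity
          simp only [mem_filter, mem_product, mem_Icc] at hx ⊢
          exact ⟨⟨Nat.pos_of_mem_divisors hx.1.1, hx.2.1⟩, Nat.pos_of_mem_divisors hx.1.2, hx.2.2⟩
  calc _ ≤ ∑ d ∈ P.divisors, ∑ x ∈ (Icc 1 D) ×ˢ (Icc 1 D),
        if d = Nat.lcm x.1 x.2 then (D : ℝ) ^ 2 else 0 := sum_le_sum key
    _ = ∑ x ∈ (Icc 1 D) ×ˢ (Icc 1 D), ∑ d ∈ P.divisors,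
        if d = Nat.lcm x.1 x.2 then (D : ℝ) ^ 2 else 0 := sum_comm
    _ ≤ ∑ x ∈ (Icc 1 D) ×ˢ (Icc 1 D), (D : ℝ) ^ 2 := by
        refine sum_le_sum fun x _ => ?_
        rw [sum_ite_eq']
        split_ifs
        · exact le_rfl
        · positivity
    _ = (D : ℝ) ^ 4 := by
        rw [sum_const, card_product, Nat.card_Icc]; simp; ring

/-- The Selberg upper bound sieve, with a crude bound for the error term. -/
theorem siftedSum_le_selberg (hD : 1 ≤ D)
    (hν : ∀ d, d ∣ s.prodPrimes → (s.nu d)⁻¹ ≤ d)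
    (hr : ∀ d, d ∣ s.prodPrimes → |s.rem d| ≤ 1) :
    s.siftedSum ≤ s.totalMass * (selbergSum s D)⁻¹ + (D : ℝ) ^ 4 := by
  have h := BoundingSieve.siftedSum_le_mainSum_errSum_of_upperMoebius (s := s) _
    (BoundingSieve.upperMoebius_lambdaSquared (selbergWeight s D) (selbergWeight_one hD))
  rw [mainSum_selbergWeight hD] at h
  linarith [errSum_selbergWeight_le hD hν hr]

end

/-! ### Sieving an arithmetic progression -/

/-- The arithmetic function `n ↦ 1 / n`. -/
noncomputable def recip : ArithmeticFunction ℝ := ⟨fun n => (n : ℝ)⁻¹, by simp⟩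

@[simp] lemma recip_apply (n : ℕ) : recip n = (n : ℝ)⁻¹ := rfl

lemma recip_isMultiplicative : recip.IsMultiplicative :=
  ⟨by simp, fun {m n} _ => by simp [mul_comm]⟩

/-- The product of the primes `p ≤ D` not dividing `q`. -/
def siftingProduct (q D : ℕ) : ℕ := ∏ p ∈ Icc 1 D with p.Prime ∧ ¬ p ∣ q, p

lemma siftingProduct_squarefree (q D : ℕ) : Squarefree (siftingProduct q D) := by
  refine Finset.squarefree_prod_of_pairwise_isCoprime ?_ ?_
  · intro p hp r hr hpr
    simp only [coe_filter, Set.mem_ofPred_eq] at hp hr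
    exact (Nat.coprime_iff_isRelPrime).1 ((Nat.coprime_primes hp.2.1 hr.2.1).2 hpr)
  · intro p hp
    exact (mem_filter.1 hp).2.1.prime.squarefree

lemma prime_dvd_siftingProduct {q D p : ℕ} (hp : p.Prime) :
    p ∣ siftingProduct q D ↔ p ≤ D ∧ ¬ p ∣ q := by
  rw [siftingProduct, hp.prime.dvd_finsetProd_iff]
  constructor
  · rintro ⟨r, hr, hpr⟩
    simp only [mem_filter, mem_Icc] at hr
    rw [(Nat.prime_dvd_prime_iff_eq hp hr.2.1).1 hpr]
    exact ⟨hr.1.2, hr.2.2⟩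
  · rintro ⟨h1, h2⟩
    exact ⟨p, by simp [hp.one_le, h1, h2, hp], dvd_rfl⟩

lemma coprime_of_dvd_siftingProduct {q D d : ℕ} (hd : d ∣ siftingProduct q D) : d.Coprime q := by
  refine Nat.Coprime.coprime_dvd_left hd (Nat.Coprime.symm ?_)
  refine Nat.coprime_of_dvd fun p hp hpq hpP => ?_
  exact ((prime_dvd_siftingProduct hp).1 hpP).2 hpq

lemma abs_card_Ioc_modEq_sub_le {A N M : ℕ} (hAN : A ≤ N) (hM : 0 < M) (v : ℕ) :
    |(#{n ∈ Ioc A N | n ≡ v [MOD M]} : ℝ) - ((N : ℝ) - A) / M| ≤ 1 := by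
  have h := Nat.Ioc_filter_modEq_card A N hM v
  have hM' : (0 : ℚ) < M := by exact_mod_cast hM
  have hle : ⌊((A : ℚ) - v) / M⌋ ≤ ⌊((N : ℚ) - v) / M⌋ := by
    have : (A : ℚ) ≤ N := by exact_mod_cast hAN
    gcongr
  rw [max_eq_left (by linarith)] at h
  have h1 := Int.floor_le (((A : ℚ) - v) / M)
  have h2 := Int.lt_floor_add_one (((A : ℚ) - v) / M)
  have h3 := Int.floor_le (((N : ℚ) - v) / M)
  have h4 := Int.lt_floor_add_one (((N : ℚ) - v) / M)
  have hq : ((#{n ∈ Ioc A N | n ≡ v [MOD M]} : ℕ) : ℚ) =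
      (⌊((N : ℚ) - v) / M⌋ : ℚ) - ⌊((A : ℚ) - v) / M⌋ := by exact_mod_cast h
  have hsub : ((N : ℚ) - A) / M = (N - v) / M - (A - v) / M := by ring
  have : |((#{n ∈ Ioc A N | n ≡ v [MOD M]} : ℕ) : ℚ) - ((N : ℚ) - A) / M| ≤ 1 := by
    rw [abs_le, hq, hsub]
    constructor <;> linarith
  have h5 := (Rat.cast_le (K := ℝ)).2 this
  push_cast at h5
  exact h5

lemma abs_card_Ioc_modEq_dvd_sub_le {A N q a m : ℕ} (hAN : A ≤ N) (hq : 0 < q) (hm : 0 < m)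
    (hqm : m.Coprime q) :
    |(#{n ∈ Ioc A N | n ≡ a [MOD q] ∧ m ∣ n} : ℝ) - ((N : ℝ) - A) / (q * m)| ≤ 1 := by
  obtain ⟨v, hv1, hv2⟩ := Nat.chineseRemainder hqm.symm a 0
  have hset : {n ∈ Ioc A N | n ≡ a [MOD q] ∧ m ∣ n} = {n ∈ Ioc A N | n ≡ v [MOD q * m]} := by
    refine filter_congr fun n _ => ?_
    rw [← Nat.modEq_and_modEq_iff_modEq_mul hqm.symm, ← Nat.modEq_zero_iff_dvd]
    exact and_congr ⟨fun h => h.trans hv1.symm, fun h => h.trans hv1⟩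
      ⟨fun h => h.trans hv2.symm, fun h => h.trans hv2⟩
  rw [hset]
  have := abs_card_Ioc_modEq_sub_le hAN (Nat.mul_pos hq hm) v
  push_cast at this
  exact this

/-- The sieve problem for the cofactors `l` of the multiples `m * l` of `m` in a progression. -/
noncomputable def apSieve (A N q a m D : ℕ) : BoundingSieve where
  support := {l ∈ range (N + 1) | m * l ∈ Ioc A N ∧ m * l ≡ a [MOD q]}
  prodPrimes := siftingProduct q D
  prodPrimes_squarefree := siftingProduct_squarefree q D
  weights := fun _ => 1
  weights_nonneg := fun _ => zero_le_one
  totalMass := ((N : ℝ) - A) / (q * m)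
  nu := recip
  nu_mult := recip_isMultiplicative
  nu_pos_of_prime := fun p hp _ => by simpa using hp.pos
  nu_lt_one_of_prime := fun p hp _ => inv_lt_one_of_one_lt₀ (by exact_mod_cast hp.one_lt)

lemma abs_rem_apSieve_le {A N q a m D d : ℕ} (hAN : A ≤ N) (hq : 0 < q) (hm : 0 < m)
    (hqm : m.Coprime q) (hd : d ∣ siftingProduct q D) :
    |(apSieve A N q a m D).rem d| ≤ 1 := by
  have hd0 : 0 < d := Nat.pos_of_dvd_of_pos hd
    (Nat.pos_of_ne_zero (siftingProduct_squarefree q D).ne_zero)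
  have h := abs_card_Ioc_modEq_dvd_sub_le (a := a) hAN hq (Nat.mul_pos hm hd0)
    (hqm.mul_left (coprime_of_dvd_siftingProduct hd))
  have hset : {n ∈ Ioc A N | n ≡ a [MOD q] ∧ m * d ∣ n} =
      ({l ∈ (apSieve A N q a m D).support | d ∣ l}).image (m * ·) := by
    ext n
    simp only [apSieve, mem_filter, mem_image, mem_range]
    constructor
    · rintro ⟨h1, h2, c, rfl⟩
      refine ⟨d * c, ⟨⟨?_, ?_, ?_⟩, dvd_mul_right _ _⟩, by ring⟩
      · have := (mem_Ioc.1 h1).2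
        have : d * c ≤ m * d * c := by rw [mul_assoc]; exact Nat.le_mul_of_pos_left _ hm
        omega
      · rwa [← mul_assoc]
      · rwa [← mul_assoc]
    · rintro ⟨l, ⟨⟨_, h1, h2⟩, h3⟩, rfl⟩
      exact ⟨h1, h2, Nat.mul_dvd_mul_left m h3⟩
  rw [hset, card_image_of_injective _ fun a b h => Nat.eq_of_mul_eq_mul_left hm h] at h
  have hrem : (apSieve A N q a m D).rem d =
      (#{l ∈ (apSieve A N q a m D).support | d ∣ l} : ℝ) -
        ((N : ℝ) - A) / (q * ((m * d : ℕ) : ℝ)) := by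
    simp only [BoundingSieve.rem, BoundingSieve.multSum]
    rw [card_eq_sum_ones, sum_filter]
    simp only [apSieve, recip_apply]
    push_cast
    congr 1
    ring
  rw [hrem]
  exact h

lemma totient_eq_mul_prod_factors (n : ℕ) :
    (n.totient : ℝ) = n * ∏ p ∈ n.primeFactors, (1 - (p : ℝ)⁻¹) := by
  have h := congrArg (Rat.cast : ℚ → ℝ) (Nat.totient_eq_mul_prod_factors n)
  push_cast at h
  exact h

lemma selbergTerms_apSieve (A N q a m D l : ℕ) :
    (apSieve A N q a m D).selbergTerms l = ((l.totient : ℝ))⁻¹ := by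
  rw [BoundingSieve.selbergTerms_apply]
  rw [totient_eq_mul_prod_factors, mul_inv, prod_inv_distrib]
  rfl

lemma hasSum_inv_factoredNumbers {n : ℕ} (hn : n ≠ 0) :
    HasSum (fun t : Nat.factoredNumbers n.primeFactors => ((t : ℕ) : ℝ)⁻¹) (n / n.totient) := by
  let f : ℕ →* ℝ := ⟨⟨fun n => (n : ℝ)⁻¹, by simp⟩, fun a b => by simp [mul_comm]⟩
  have h := (EulerProduct.summable_and_hasSum_factoredNumbers_prod_filter_prime_geometric (f := f)
    (fun {p} hp => by
      change ‖((p : ℝ))⁻¹‖ < 1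
      rw [norm_inv, Real.norm_natCast]
      exact inv_lt_one_of_one_lt₀ (by exact_mod_cast hp.one_lt)) n.primeFactors).2
  have hf : n.primeFactors.filter Nat.Prime = n.primeFactors :=
    filter_true_of_mem fun p hp => Nat.prime_of_mem_primeFactors hp
  have h3 : (n : ℝ) / n.totient = ∏ p ∈ n.primeFactors with p.Prime, (1 - f p)⁻¹ := by
    rw [hf, prod_inv_distrib, totient_eq_mul_prod_factors]
    have : (n : ℝ) ≠ 0 := by exact_mod_cast hn
    change _ = (∏ p ∈ n.primeFactors, (1 - (p : ℝ)⁻¹))⁻¹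
    field_simp
  rw [h3]
  exact h

lemma log_le_sum_inv_totient {q D : ℕ} (hq : 0 < q) (hD : 1 ≤ D) :
    Real.log D ≤ (q / q.totient : ℝ) *
      ∑ l ∈ (siftingProduct q D).divisors with l ≤ D, ((l.totient : ℝ))⁻¹ := by
  classical
  let r : ℕ → ℕ := fun n => ∏ p ∈ n.primeFactors with ¬ p ∣ q, p
  have hrdvd : ∀ n, n ≠ 0 → r n ∣ n := fun n hn =>
    (prod_dvd_prod_of_subset _ _ _ (filter_subset _ _)).trans (Nat.prod_primeFactors_dvd n)
  have hlog : Real.log D ≤ ∑ n ∈ Icc 1 D, ((n : ℝ))⁻¹ := by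
    have h : Real.log D ≤ harmonic D := (Real.log_le_log (by exact_mod_cast hD)
      (by push_cast; linarith)).trans (log_add_one_le_harmonic D)
    rw [harmonic_eq_sum_Icc] at h
    push_cast at h
    exact h
  refine hlog.trans ?_
  have hmaps : ∀ n ∈ Icc 1 D, r n ∈ (siftingProduct q D).divisors.filter (· ≤ D) := by
    intro n hn
    rw [mem_Icc] at hn
    have hn0 : n ≠ 0 := by omega
    refine mem_filter.2 ⟨Nat.mem_divisors.2 ⟨?_, (siftingProduct_squarefree q D).ne_zero⟩,
      (Nat.le_of_dvd (by omega) (hrdvd n hn0)).trans hn.2⟩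
    refine prod_dvd_prod_of_subset _ _ _ fun p hp => ?_
    simp only [mem_filter, Nat.mem_primeFactors, mem_Icc] at hp ⊢
    exact ⟨⟨hp.1.1.one_le, (Nat.le_of_dvd (by omega) hp.1.2.1).trans hn.2⟩, hp.1.1, hp.2⟩
  rw [← sum_fiberwise_of_maps_to hmaps, mul_sum]
  refine sum_le_sum fun l hl => ?_
  obtain ⟨hlP, hlD⟩ := mem_filter.1 hl
  have hlP' := Nat.dvd_of_mem_divisors hlP
  have hl0 : 0 < l := Nat.pos_of_mem_divisors hlP
  have hcop := coprime_of_dvd_siftingProduct hlP'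
  have hs := hasSum_inv_factoredNumbers (n := l * q) (by positivity)
  have hdiv : ∀ n ∈ (Icc 1 D).filter (fun n => r n = l), l ∣ n ∧ n ≠ 0 := by
    intro n hn
    simp only [mem_filter, mem_Icc] at hn
    have hn0 : n ≠ 0 := by omega
    exact ⟨hn.2 ▸ hrdvd n hn0, hn0⟩
  have hmem : ∀ n ∈ (Icc 1 D).filter (fun n => r n = l),
      n / l ∈ Nat.factoredNumbers (l * q).primeFactors := by
    intro n hn
    obtain ⟨hln, hn0⟩ := hdiv n hn
    rw [Nat.mem_factoredNumbers']
    intro p hp hpn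
    refine Nat.mem_primeFactors.2 ⟨hp, ?_, by positivity⟩
    by_cases hpq : p ∣ q
    · exact hpq.mul_left l
    · refine Dvd.dvd.mul_right ?_ q
      rw [← (mem_filter.1 hn).2]
      refine dvd_prod_of_mem _ (mem_filter.2 ⟨Nat.mem_primeFactors.2 ⟨hp, ?_, hn0⟩, hpq⟩)
      exact hpn.trans (Nat.div_dvd_of_dvd hln)
  have hbound : ∑ n ∈ (Icc 1 D).filter (fun n => r n = l), (((n / l : ℕ)) : ℝ)⁻¹ ≤
      ((l * q : ℕ) : ℝ) / ((l * q).totient : ℕ) := by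
    let e : {n // n ∈ (Icc 1 D).filter (fun n => r n = l)} →
        Nat.factoredNumbers (l * q).primeFactors := fun n => ⟨n.1 / l, hmem n.1 n.2⟩
    rw [← sum_attach]
    change ∑ n ∈ ((Icc 1 D).filter (fun n => r n = l)).attach, (((e n : ℕ)) : ℝ)⁻¹ ≤ _
    rw [← sum_image (g := e)
      (f := fun t : Nat.factoredNumbers (l * q).primeFactors => ((t : ℕ) : ℝ)⁻¹)]
    · exact sum_le_hasSum _ (fun t _ => by positivity) hs
    · intro n _ n' _ h
      have h' : n.1 / l = n'.1 / l := congrArg Subtype.val h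
      exact Subtype.ext ((Nat.div_left_inj (hdiv n.1 n.2).1 (hdiv n'.1 n'.2).1).1 h')
  have hl' : (0 : ℝ) < l := by exact_mod_cast hl0
  calc ∑ n ∈ (Icc 1 D).filter (fun n => r n = l), ((n : ℝ))⁻¹
      = (l : ℝ)⁻¹ * ∑ n ∈ (Icc 1 D).filter (fun n => r n = l), (((n / l : ℕ)) : ℝ)⁻¹ := by
        rw [mul_sum]
        refine sum_congr rfl fun n hn => ?_
        rw [Nat.cast_div (hdiv n hn).1 hl'.ne', inv_div]
        field_simp
    _ ≤ (l : ℝ)⁻¹ * (((l * q : ℕ) : ℝ) / ((l * q).totient : ℕ)) := by gcongr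
    _ = _ := by
        rw [Nat.totient_mul hcop]
        push_cast
        have : (l.totient : ℝ) ≠ 0 := by exact_mod_cast (Nat.totient_pos.2 hl0).ne'
        have : (q.totient : ℝ) ≠ 0 := by exact_mod_cast (Nat.totient_pos.2 hq).ne'
        field_simp

/-- Upper bound for the number of multiples of `m` in a reduced residue class, the cofactor of
which has no prime factor up to `D`. -/
theorem card_rough_le {A N q a m D : ℕ} (hAN : A ≤ N) (hq : 0 < q) (hm : 0 < m)
    (hqm : m.Coprime q) (hD : 2 ≤ D) :
    (#{n ∈ Ioc A N | n ≡ a [MOD q] ∧ m ∣ n ∧ ∀ p ≤ D, p.Prime → ¬ p ∣ n / m} : ℝ) ≤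
      ((N : ℝ) - A) / (q.totient * m * Real.log D) + (D : ℝ) ^ 4 := by
  have hD1 : 1 ≤ D := by omega
  set s := apSieve A N q a m D with hs
  have hP : s.prodPrimes = siftingProduct q D := rfl
  have hsel := siftedSum_le_selberg (s := s) hD1 (fun d _ => by simp [hs, apSieve])
    (fun d hd => abs_rem_apSieve_le hAN hq hm hqm hd)
  have hsum : selbergSum s D =
      ∑ l ∈ (siftingProduct q D).divisors with l ≤ D, ((l.totient : ℝ))⁻¹ :=
    sum_congr rfl fun l _ => selbergTerms_apSieve A N q a m D l
  have hlog := log_le_sum_inv_totient hq hD1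
  rw [← hsum] at hlog
  have hlogD : 0 < Real.log D := Real.log_pos (by exact_mod_cast hD)
  have hS := selbergSum_pos (s := s) hD1
  have hφ : (0 : ℝ) < q.totient := by exact_mod_cast Nat.totient_pos.2 hq
  have hq' : (0 : ℝ) < q := by exact_mod_cast hq
  have hm' : (0 : ℝ) < m := by exact_mod_cast hm
  have hH : (0 : ℝ) ≤ (N : ℝ) - A := by
    have : (A : ℝ) ≤ N := by exact_mod_cast hAN
    linarith
  have hmain : s.totalMass * (selbergSum s D)⁻¹ ≤
      ((N : ℝ) - A) / (q.totient * m * Real.log D) := by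
    change ((N : ℝ) - A) / (q * m) * (selbergSum s D)⁻¹ ≤ _
    rw [← div_eq_mul_inv, div_div]
    refine div_le_div_of_nonneg_left hH (by positivity) ?_
    calc (q.totient : ℝ) * m * Real.log D ≤
          q.totient * m * ((q / q.totient : ℝ) * selbergSum s D) := by gcongr
      _ = q * m * selbergSum s D := by field_simp
  have hcount : (#{n ∈ Ioc A N | n ≡ a [MOD q] ∧ m ∣ n ∧
      ∀ p ≤ D, p.Prime → ¬ p ∣ n / m} : ℝ) ≤ s.siftedSum := by
    have h1 : s.siftedSum = #{l ∈ s.support | (siftingProduct q D).Coprime l} := by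
      rw [BoundingSieve.siftedSum, card_eq_sum_ones, sum_filter]
      push_cast
      rfl
    rw [h1]
    norm_cast
    refine card_le_card_of_injOn (· / m) ?_ ?_
    · intro n hn
      simp only [coe_filter, Set.mem_ofPred_eq] at hn
      obtain ⟨h1, h2, ⟨c, rfl⟩, h4⟩ := hn
      rw [Nat.mul_div_cancel_left _ hm] at h4
      simp only [coe_filter, Set.mem_ofPred_eq, Nat.mul_div_cancel_left _ hm, hs, apSieve,
        mem_filter, mem_range]
      refine ⟨⟨?_, h1, h2⟩, ?_⟩
      · have := (mem_Ioc.1 h1).2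
        have : c ≤ m * c := Nat.le_mul_of_pos_left _ hm
        omega
      · refine Nat.coprime_of_dvd fun p hp hpP hpc => ?_
        exact h4 p ((prime_dvd_siftingProduct hp).1 hpP).1 hp hpc
    · intro n hn n' hn' h
      simp only [coe_filter, Set.mem_ofPred_eq] at hn hn'
      exact (Nat.div_left_inj hn.2.2.1 hn'.2.2.1).1 h
  linarith

/-! ### Smooth parts -/

/-- The largest divisor of `n` composed of primes `p ≤ w`. -/
def smoothPart (w n : ℕ) : ℕ := ∏ p ∈ n.primeFactors with p ≤ w, p ^ n.factorization p

/-- The largest divisor of `n` composed of primes `p > w`. -/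
def roughPart (w n : ℕ) : ℕ := ∏ p ∈ n.primeFactors with ¬ p ≤ w, p ^ n.factorization p

lemma smoothPart_mul_roughPart (w : ℕ) {n : ℕ} (hn : n ≠ 0) :
    smoothPart w n * roughPart w n = n := by
  rw [smoothPart, roughPart, prod_filter_mul_prod_filter_not]
  exact Nat.prod_factorization_pow_eq_self hn

lemma le_of_prime_dvd_smoothPart {w n p : ℕ} (hp : p.Prime) (h : p ∣ smoothPart w n) :
    p ≤ w := by
  obtain ⟨r, hr, hpr⟩ := (hp.prime.dvd_finsetProd_iff _).1 h
  obtain ⟨hr1, hr2⟩ := mem_filter.1 hr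
  rwa [(Nat.prime_dvd_prime_iff_eq hp (Nat.prime_of_mem_primeFactors hr1)).1
    (hp.dvd_of_dvd_pow hpr)]

lemma lt_of_prime_dvd_roughPart {w n p : ℕ} (hp : p.Prime) (h : p ∣ roughPart w n) :
    w < p := by
  obtain ⟨r, hr, hpr⟩ := (hp.prime.dvd_finsetProd_iff _).1 h
  obtain ⟨hr1, hr2⟩ := mem_filter.1 hr
  rw [(Nat.prime_dvd_prime_iff_eq hp (Nat.prime_of_mem_primeFactors hr1)).1
    (hp.dvd_of_dvd_pow hpr)]
  omega

lemma coprime_of_smooth_of_rough {w b d : ℕ} (hb : ∀ p, p.Prime → p ∣ b → p ≤ w)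
    (hd : ∀ p, p.Prime → p ∣ d → w < p) : b.Coprime d :=
  Nat.coprime_of_dvd fun p hp h1 h2 => (hd p hp h2).not_ge (hb p hp h1)

lemma smoothPart_eq {w b d : ℕ} (h0 : b * d ≠ 0) (hb : ∀ p, p.Prime → p ∣ b → p ≤ w)
    (hd : ∀ p, p.Prime → p ∣ d → w < p) : smoothPart w (b * d) = b := by
  have h := smoothPart_mul_roughPart w h0
  refine Nat.dvd_antisymm ?_ ?_
  · have hc : (smoothPart w (b * d)).Coprime d :=
      coprime_of_smooth_of_rough (fun p hp => le_of_prime_dvd_smoothPart hp) hd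
    exact hc.dvd_of_dvd_mul_right (Dvd.intro _ h)
  · have hc : b.Coprime (roughPart w (b * d)) :=
      coprime_of_smooth_of_rough hb (fun p hp => lt_of_prime_dvd_roughPart hp)
    exact hc.dvd_of_dvd_mul_right (h.symm ▸ dvd_mul_right _ _)

lemma smoothPart_mul (w : ℕ) {m n : ℕ} (hm : m ≠ 0) (hn : n ≠ 0) :
    smoothPart w (m * n) = smoothPart w m * smoothPart w n := by
  have h : m * n = (smoothPart w m * smoothPart w n) * (roughPart w m * roughPart w n) := by
    conv_lhs => rw [← smoothPart_mul_roughPart w hm, ← smoothPart_mul_roughPart w hn]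
    ring
  rw [h]
  refine smoothPart_eq (h ▸ mul_ne_zero hm hn) (fun p hp hpd => ?_) fun p hp hpd => ?_
  · rcases hp.dvd_mul.1 hpd with h | h <;> exact le_of_prime_dvd_smoothPart hp h
  · rcases hp.dvd_mul.1 hpd with h | h <;> exact lt_of_prime_dvd_roughPart hp h

lemma smoothPart_eq_self {w n : ℕ} (hn : n ≠ 0) (h : ∀ p, p.Prime → p ∣ n → p ≤ w) :
    smoothPart w n = n := by
  have := smoothPart_eq (w := w) (b := n) (d := 1) (by simpa using hn) h
    (fun p hp h1 => absurd (Nat.dvd_one.1 h1) hp.ne_one)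
  simpa using this

lemma smoothPart_eq_one {w n : ℕ} (hn : n ≠ 0) (h : ∀ p, p.Prime → p ∣ n → w < p) :
    smoothPart w n = 1 := by
  have := smoothPart_eq (w := w) (b := 1) (d := n) (by simpa using hn)
    (fun p hp h1 => absurd (Nat.dvd_one.1 h1) hp.ne_one) h
  simpa using this

lemma smoothPart_zero (w : ℕ) : smoothPart w 0 = 1 := by simp [smoothPart]

lemma smoothPart_one (w : ℕ) : smoothPart w 1 = 1 := by simp [smoothPart]

lemma smoothPart_prime_pow {w p : ℕ} (hp : p.Prime) (e : ℕ) :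
    smoothPart w (p ^ e) = if p ≤ w then p ^ e else 1 := by
  have h0 : p ^ e ≠ 0 := pow_ne_zero _ hp.ne_zero
  split_ifs with h
  · refine smoothPart_eq_self h0 fun r hr hrp => ?_
    rwa [(Nat.prime_dvd_prime_iff_eq hr hp).1 (hr.dvd_of_dvd_pow hrp)]
  · refine smoothPart_eq_one h0 fun r hr hrp => ?_
    rw [(Nat.prime_dvd_prime_iff_eq hr hp).1 (hr.dvd_of_dvd_pow hrp)]
    omega

lemma smoothPart_ne_zero (w n : ℕ) : smoothPart w n ≠ 0 := by
  rcases eq_or_ne n 0 with rfl | hn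
  · simp [smoothPart_zero]
  · exact left_ne_zero_of_mul ((smoothPart_mul_roughPart w hn).symm ▸ hn)

lemma smoothPart_dvd (w : ℕ) {n : ℕ} (hn : n ≠ 0) : smoothPart w n ∣ n :=
  Dvd.intro _ (smoothPart_mul_roughPart w hn)

/-- If `b ∣ s`, `b ≤ y < s`, and the primes dividing `s` are at most `W`, some multiple of `b`
dividing `s` lies in `(y, y W]`. -/
lemma exists_medium_divisor {b s y W : ℕ} (hbs : b ∣ s) (hby : b ≤ y) (hys : y < s)
    (hW : ∀ p, p.Prime → p ∣ s → p ≤ W) : ∃ m, b ∣ m ∧ m ∣ s ∧ y < m ∧ m ≤ y * W := by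
  classical
  have hex : ∃ m, b ∣ m ∧ m ∣ s ∧ y < m := ⟨s, hbs, dvd_rfl, hys⟩
  obtain ⟨h1, h2, h3⟩ := Nat.find_spec hex
  set m := Nat.find hex with hm
  refine ⟨m, h1, h2, h3, ?_⟩
  obtain ⟨c, hc⟩ := h1
  have hc1 : c ≠ 1 := by rintro rfl; omega
  obtain ⟨p, hp, t, rfl⟩ := Nat.exists_prime_and_dvd hc1
  have hmt : m = p * (b * t) := by rw [hc]; ring
  have hlt : b * t < m := by
    have := hp.two_le
    have hpos : 0 < b * t := by
      rcases Nat.eq_zero_or_pos (b * t) with h | h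
      · rw [h] at hmt; omega
      · exact h
    nlinarith
  have hnot := Nat.find_min hex hlt
  have hle : b * t ≤ y := by
    by_contra hcon
    exact hnot ⟨dvd_mul_right _ _, (hmt ▸ dvd_mul_left _ _ : b * t ∣ m).trans h2, by omega⟩
  have hpW : p ≤ W := hW p hp ((hmt ▸ dvd_mul_right _ _ : p ∣ m).trans h2)
  rw [hmt, mul_comm]
  exact Nat.mul_le_mul hle hpW

/-! ### Nonnegative multiplicative functions of divisor type -/

/-- A nonnegative multiplicative function bounded by the `K`-th power of the divisor function. -/
structure IsDivisorBounded (K : ℕ) (g : ℕ → ℝ) : Prop where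
  nonneg : ∀ n, 0 ≤ g n
  map_one : g 1 = 1
  map_mul : ∀ m n : ℕ, m.Coprime n → g (m * n) = g m * g n
  prime_pow_le : ∀ p e : ℕ, p.Prime → g (p ^ e) ≤ ((e : ℝ) + 1) ^ K

namespace IsDivisorBounded

variable {K : ℕ} {g : ℕ → ℝ}

lemma prime_le (hg : IsDivisorBounded K g) {p : ℕ} (hp : p.Prime) : g p ≤ 2 ^ K := by
  have := hg.prime_pow_le p 1 hp
  rw [pow_one] at this
  norm_num at this
  exact this

lemma comp_smoothPart (hg : IsDivisorBounded K g) (w : ℕ) :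
    IsDivisorBounded K fun n => g (smoothPart w n) where
  nonneg n := hg.nonneg _
  map_one := by simp [smoothPart_one, hg.map_one]
  map_mul m n h := by
    rcases eq_or_ne m 0 with rfl | hm
    · obtain rfl : n = 1 := by simpa using h
      simp [smoothPart_one, hg.map_one]
    rcases eq_or_ne n 0 with rfl | hn
    · obtain rfl : m = 1 := by simpa using h
      simp [smoothPart_one, hg.map_one]
    rw [smoothPart_mul w hm hn]
    exact hg.map_mul _ _ ((h.coprime_dvd_left (smoothPart_dvd w hm)).coprime_dvd_right
      (smoothPart_dvd w hn))
  prime_pow_le p e hp := by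
    rw [smoothPart_prime_pow hp]
    split_ifs
    · exact hg.prime_pow_le p e hp
    · rw [hg.map_one]
      exact one_le_pow₀ (by linarith [e.cast_nonneg (α := ℝ)])

lemma one : IsDivisorBounded K fun _ => (1 : ℝ) where
  nonneg _ := zero_le_one
  map_one := rfl
  map_mul _ _ _ := by simp
  prime_pow_le _ e _ := one_le_pow₀ (by linarith [e.cast_nonneg (α := ℝ)])

end IsDivisorBounded

/-! ### Prime sums and the Rankin method -/

lemma pow_dvd_factorial_mul {p : ℕ} (hp : 0 < p) (k : ℕ) : p ^ k ∣ (p * k).factorial := by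
  induction k with
  | zero => simp
  | succ k ih =>
    rw [pow_succ, mul_add, mul_one]
    exact (mul_dvd_mul ih (Nat.dvd_factorial hp le_rfl)).trans
      (Nat.factorial_mul_factorial_dvd_factorial_add _ _)

lemma sum_log_div_prime_le {N : ℕ} (hN : 1 ≤ N) :
    ∑ p ∈ Icc 1 N with p.Prime, Real.log p / p ≤ 2 * Real.log N := by
  have hdvd : ∏ p ∈ Icc 1 N with p.Prime, p ^ (N / p) ∣ N.factorial := by
    refine Finset.prod_dvd_of_isRelPrime ?_ ?_
    · intro p hp r hr hpr
      simp only [coe_filter, Set.mem_ofPred_eq] at hp hr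
      exact Nat.coprime_iff_isRelPrime.1
        (Nat.Coprime.pow _ _ ((Nat.coprime_primes hp.2 hr.2).2 hpr))
    · intro p hp
      exact (pow_dvd_factorial_mul (mem_filter.1 hp).2.pos _).trans
        (Nat.factorial_dvd_factorial (Nat.mul_div_le N p))
  have hle : ∏ p ∈ Icc 1 N with p.Prime, p ^ (N / p) ≤ N ^ N :=
    (Nat.le_of_dvd (Nat.factorial_pos N) hdvd).trans (Nat.factorial_le_pow N)
  have hpos : 0 < ∏ p ∈ Icc 1 N with p.Prime, p ^ (N / p) :=
    prod_pos fun p hp => pow_pos (mem_filter.1 hp).2.pos _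
  have hlog : ∑ p ∈ Icc 1 N with p.Prime, ((N / p : ℕ) : ℝ) * Real.log p ≤ N * Real.log N := by
    have h := Real.log_le_log (by exact_mod_cast hpos) (Nat.cast_le (α := ℝ).2 hle)
    push_cast at h
    rw [Real.log_prod (fun p hp => by
      have := (mem_filter.1 hp).2.pos
      positivity), Real.log_pow] at h
    simpa only [Real.log_pow] using h
  have hN' : (0 : ℝ) < N := by exact_mod_cast hN
  have hterm : ∀ p ∈ (Icc 1 N).filter Nat.Prime,
      (N : ℝ) / 2 * (Real.log p / p) ≤ ((N / p : ℕ) : ℝ) * Real.log p := by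
    intro p hp
    obtain ⟨hp1, hp2⟩ := mem_filter.1 hp
    have hpN : p ≤ N := (mem_Icc.1 hp1).2
    have hp0 : (0 : ℝ) < p := by exact_mod_cast hp2.pos
    have h1 : (1 : ℝ) ≤ ((N / p : ℕ) : ℝ) := by
      exact_mod_cast (Nat.one_le_div_iff hp2.pos).2 hpN
    have h2 : (N : ℝ) / p < ((N / p : ℕ) : ℝ) + 1 := by
      rw [div_lt_iff₀ hp0]
      exact_mod_cast Nat.lt_mul_of_div_lt (Nat.lt_succ_self (N / p)) hp2.pos
    have hlp : 0 ≤ Real.log p := Real.log_natCast_nonneg p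
    calc (N : ℝ) / 2 * (Real.log p / p) = (N / p) / 2 * Real.log p := by ring
      _ ≤ ((N / p : ℕ) : ℝ) * Real.log p := by gcongr; linarith
  have hfin := (sum_le_sum hterm).trans hlog
  rw [← mul_sum] at hfin
  nlinarith

lemma summable_add_pow_mul_geometric (K j : ℕ) {r : ℝ} (hr0 : 0 < r) (hr : r < 1) :
    Summable fun e : ℕ => ((e : ℝ) + j) ^ K * r ^ e := by
  have h := summable_pow_mul_geometric_of_norm_lt_one (R := ℝ) K
    (r := r) (by rwa [Real.norm_of_nonneg hr0.le])
  refine (((summable_nat_add_iff j).2 h).mul_right (r ^ j)⁻¹).congr fun e => ?_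
  push_cast
  rw [pow_add]
  field_simp

theorem sum_rpow_le_exp (K : ℕ) : ∃ C : ℝ, ∀ (h : ℕ → ℝ), IsDivisorBounded K h →
    ∀ α : ℝ, 0 ≤ α → α ≤ 1 / 4 → ∀ P M : Finset ℕ, (∀ p ∈ P, p.Prime) →
    (∀ m ∈ M, m ∈ Nat.factoredNumbers P) →
    ∑ m ∈ M, h m * (m : ℝ) ^ (α - 1) ≤
      Real.exp (C + ∑ p ∈ P, h p * (p : ℝ) ^ (α - 1)) := by
  set r : ℝ := (2 : ℝ) ^ (-(3 / 4) : ℝ) with hr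
  have hr0 : 0 < r := by positivity
  have hr1 : r < 1 := Real.rpow_lt_one_of_one_lt_of_neg (by norm_num) (by norm_num)
  have hsum3 := summable_add_pow_mul_geometric K 3 hr0 hr1
  have hsum1 := summable_add_pow_mul_geometric K 1 hr0 hr1
  set c : ℝ := ∑' e : ℕ, ((e : ℝ) + (3 : ℕ)) ^ K * r ^ e with hc
  have hc0 : 0 ≤ c := tsum_nonneg fun e => by positivity
  have hz : Summable fun n : ℕ => (n : ℝ) ^ (-(3 / 2) : ℝ) :=
    Real.summable_nat_rpow.2 (by norm_num)
  refine ⟨c * ∑' n : ℕ, (n : ℝ) ^ (-(3 / 2) : ℝ), ?_⟩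
  intro h hh α hα0 hα P M hP hM
  let f : ℕ → ℝ := fun m => h m * (m : ℝ) ^ (α - 1)
  have hf0 : ∀ m, 0 ≤ f m := fun m => mul_nonneg (hh.nonneg m) (by positivity)
  have hf1 : f 1 = 1 := by simp [f, hh.map_one]
  have hfm : ∀ {m n : ℕ}, m.Coprime n → f (m * n) = f m * f n := by
    intro m n hmn
    simp only [f, hh.map_mul m n hmn, Nat.cast_mul]
    rw [Real.mul_rpow (by positivity) (by positivity)]
    ring
  have ht : ∀ p : ℕ, p.Prime → (p : ℝ) ^ (α - 1) ≤ (p : ℝ) ^ (-(3 / 4) : ℝ) ∧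
      (p : ℝ) ^ (-(3 / 4) : ℝ) ≤ r := by
    intro p hp
    have hp2 : (2 : ℝ) ≤ p := by exact_mod_cast hp.two_le
    exact ⟨Real.rpow_le_rpow_of_exponent_le (by linarith) (by linarith),
      Real.rpow_le_rpow_of_nonpos (by norm_num) hp2 (by norm_num)⟩
  have hfp : ∀ p e : ℕ, f (p ^ e) = h (p ^ e) * ((p : ℝ) ^ (α - 1)) ^ e := by
    intro p e
    simp only [f, Nat.cast_pow]
    rw [← Real.rpow_natCast, ← Real.rpow_mul (by positivity), mul_comm (e : ℝ),
      Real.rpow_mul (by positivity), Real.rpow_natCast]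
  have hfs : ∀ {p : ℕ}, p.Prime → Summable fun e : ℕ => ‖f (p ^ e)‖ := by
    intro p hp
    refine Summable.of_nonneg_of_le (fun _ => norm_nonneg _) (fun e => ?_) hsum1
    rw [Real.norm_of_nonneg (hf0 _), hfp]
    gcongr
    · simpa using hh.prime_pow_le p e hp
    · exact (ht p hp).1.trans (ht p hp).2
  have hprod := (EulerProduct.summable_and_hasSum_factoredNumbers_prod_filter_prime_tsum
    hf1 hfm hfs P).2
  have hle1 : ∑ m ∈ M, f m ≤ ∏ p ∈ P with p.Prime, ∑' e : ℕ, f (p ^ e) := by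
    let e : {n // n ∈ M} → Nat.factoredNumbers P := fun n => ⟨n.1, hM n.1 n.2⟩
    rw [← sum_attach]
    change ∑ n ∈ M.attach, f (e n) ≤ _
    rw [← sum_image (g := e) (f := fun t : Nat.factoredNumbers P => f t)]
    · exact sum_le_hasSum _ (fun t _ => hf0 _) hprod
    · intro n _ n' _ hn
      exact Subtype.ext (congrArg (fun t : Nat.factoredNumbers P => (t : ℕ)) hn)
  refine hle1.trans ?_
  rw [filter_true_of_mem hP]
  have hfac : ∀ p ∈ P, ∑' e : ℕ, f (p ^ e) ≤
      Real.exp (c * (p : ℝ) ^ (-(3 / 2) : ℝ) + h p * (p : ℝ) ^ (α - 1)) := by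
    intro p hpP
    have hp := hP p hpP
    have hs : Summable fun e : ℕ => f (p ^ e) := (hfs hp).of_norm
    rw [← hs.sum_add_tsum_nat_add 2, sum_range_succ, sum_range_one, pow_zero, hf1, pow_one]
    have htail : ∑' e : ℕ, f (p ^ (e + 2)) ≤ c * (p : ℝ) ^ (-(3 / 2) : ℝ) := by
      rw [hc, ← tsum_mul_right]
      refine Summable.tsum_le_tsum (fun e => ?_) ((summable_nat_add_iff 2).2 hs)
        (hsum3.mul_right _)
      rw [hfp, pow_add ((p : ℝ) ^ (α - 1)) e 2]
      have hsq : ((p : ℝ) ^ (α - 1)) ^ 2 ≤ (p : ℝ) ^ (-(3 / 2) : ℝ) := by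
        calc ((p : ℝ) ^ (α - 1)) ^ 2 ≤ ((p : ℝ) ^ (-(3 / 4) : ℝ)) ^ 2 :=
              pow_le_pow_left₀ (by positivity) (ht p hp).1 2
          _ = (p : ℝ) ^ (-(3 / 2) : ℝ) := by
              rw [← Real.rpow_natCast, ← Real.rpow_mul (by positivity)]
              norm_num
      rw [← mul_assoc]
      gcongr
      · have := hh.prime_pow_le p (e + 2) hp
        push_cast at this ⊢
        rwa [show (e : ℝ) + 2 + 1 = e + 3 by ring] at this
      · exact (ht p hp).1.trans (ht p hp).2
    have := Real.add_one_le_exp (c * (p : ℝ) ^ (-(3 / 2) : ℝ) + h p * (p : ℝ) ^ (α - 1))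
    simp only [f]
    simp only [f] at htail
    linarith
  calc ∏ p ∈ P, ∑' e : ℕ, f (p ^ e) ≤
        ∏ p ∈ P, Real.exp (c * (p : ℝ) ^ (-(3 / 2) : ℝ) + h p * (p : ℝ) ^ (α - 1)) :=
        prod_le_prod (fun p _ => tsum_nonneg fun e => hf0 _) hfac
    _ = Real.exp (c * ∑ p ∈ P, (p : ℝ) ^ (-(3 / 2) : ℝ) + ∑ p ∈ P, h p * (p : ℝ) ^ (α - 1)) := by
        rw [← Real.exp_sum, sum_add_distrib, mul_sum]
    _ ≤ _ := by
        gcongr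
        exact hz.sum_le_tsum P fun n _ => by positivity

/-- The Rankin bound for the sum of a multiplicative function over `w ^ 2`-smooth integers, where
only the `w`-smooth part is weighted. -/
theorem sum_smoothPart_rpow_le (K : ℕ) (c : ℝ) : ∃ C : ℝ, 0 < C ∧
    ∀ (g : ℕ → ℝ), IsDivisorBounded K g → ∀ (α : ℝ) (w q : ℕ) (M : Finset ℕ),
    0 ≤ α → α ≤ 1 / 4 → 2 ≤ w → α * Real.log w ≤ c →
    (∀ m ∈ M, m ≠ 0 ∧ ∀ p, p.Prime → p ∣ m → p ≤ w ^ 2 ∧ ¬ p ∣ q) →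
    ∑ m ∈ M, g (smoothPart w m) * (m : ℝ) ^ (α - 1) ≤
      C * Real.exp (∑ p ∈ Icc 1 w with p.Prime ∧ ¬ p ∣ q, g p / p) := by
  obtain ⟨C, hC⟩ := sum_rpow_le_exp K
  refine ⟨Real.exp (C + (2 ^ K * Real.exp (2 * c) * (4 * c) + 4)), Real.exp_pos _, ?_⟩
  intro g hg α w q M hα0 hα hw hαc hM
  have hlogw : 0 < Real.log w := Real.log_pos (by exact_mod_cast hw)
  have hlogW : Real.log ((w ^ 2 : ℕ) : ℝ) = 2 * Real.log w := by
    push_cast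
    rw [Real.log_pow]
    norm_num
  set h : ℕ → ℝ := fun n => g (smoothPart w n) with hh
  have hhd : IsDivisorBounded K h := hg.comp_smoothPart w
  set P : Finset ℕ := {p ∈ Icc 1 (w ^ 2) | p.Prime ∧ ¬ p ∣ q} with hP
  have hbase := hC h hhd α hα0 hα P M (fun p hp => (mem_filter.1 hp).2.1) (fun m hm => by
    rw [Nat.mem_factoredNumbers']
    intro p hp hpm
    obtain ⟨h1, h2⟩ := (hM m hm).2 p hp hpm
    exact mem_filter.2 ⟨mem_Icc.2 ⟨hp.one_le, h1⟩, hp, h2⟩)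
  refine hbase.trans ?_
  rw [← Real.exp_add]
  refine Real.exp_le_exp.2 ?_
  have hsplit : ∀ p ∈ P, h p * (p : ℝ) ^ (α - 1) ≤
      h p / p + 2 ^ K * Real.exp (2 * c) * α * (Real.log p / p) := by
    intro p hp
    obtain ⟨hp1, hp2, _⟩ := mem_filter.1 hp
    have hp0 : (0 : ℝ) < p := by exact_mod_cast hp2.pos
    have hlp : 0 ≤ Real.log p := Real.log_natCast_nonneg p
    have hpW : Real.log p ≤ 2 * Real.log w := by
      rw [← hlogW]
      exact Real.log_le_log hp0 (by exact_mod_cast (mem_Icc.1 hp1).2)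
    have hexp : (p : ℝ) ^ α ≤ 1 + α * Real.log p * Real.exp (2 * c) := by
      rw [Real.rpow_def_of_pos hp0]
      set u := Real.log p * α with hu
      have hu0 : 0 ≤ u := by positivity
      have huc : u ≤ 2 * c := by nlinarith
      have h1 := Real.add_one_le_exp (-u)
      have h2 : Real.exp u - 1 ≤ u * Real.exp u := by
        have h3 : Real.exp (-u) * Real.exp u = 1 := by rw [← Real.exp_add]; simp
        nlinarith [Real.exp_pos u]
      have h4 : Real.exp u ≤ Real.exp (2 * c) := Real.exp_le_exp.2 huc
      nlinarith
    rw [Real.rpow_sub hp0, Real.rpow_one]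
    calc h p * ((p : ℝ) ^ α / p) ≤ h p * ((1 + α * Real.log p * Real.exp (2 * c)) / p) := by
          gcongr
          exact hhd.nonneg p
      _ = h p / p + h p * (Real.exp (2 * c) * α * (Real.log p / p)) := by ring
      _ ≤ h p / p + 2 ^ K * (Real.exp (2 * c) * α * (Real.log p / p)) := by
          gcongr
          exact hhd.prime_le hp2
      _ = _ := by ring
  have hlogsum : ∑ p ∈ P, Real.log p / p ≤ 4 * Real.log w := by
    have h1 := sum_log_div_prime_le (N := w ^ 2) (Nat.one_le_pow _ _ (by omega))
    rw [hlogW] at h1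
    refine (sum_le_sum_of_subset_of_nonneg (fun p hp => ?_) fun p _ _ => ?_).trans
      (h1.trans (by linarith))
    · simp only [hP, mem_filter] at hp ⊢
      exact ⟨hp.1, hp.2.1⟩
    · exact div_nonneg (Real.log_natCast_nonneg p) (Nat.cast_nonneg p)
  have hhp : ∀ p ∈ P, h p / p ≤ (if p ≤ w then g p / p else 0) +
      (Real.log w)⁻¹ * (Real.log p / p) := by
    intro p hp
    obtain ⟨hp1, hp2, _⟩ := mem_filter.1 hp
    have hp0 : (0 : ℝ) < p := by exact_mod_cast hp2.pos
    have hsm := smoothPart_prime_pow (w := w) hp2 1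
    rw [pow_one] at hsm
    simp only [hh, hsm]
    have hlp : 0 ≤ Real.log p := Real.log_natCast_nonneg p
    split_ifs with hpw
    · have : 0 ≤ (Real.log w)⁻¹ * (Real.log p / p) := by positivity
      linarith
    · rw [hg.map_one, zero_add, ← mul_div_assoc]
      gcongr
      rw [inv_mul_eq_div, one_le_div hlogw]
      exact Real.log_le_log (by positivity) (by exact_mod_cast (by omega : w ≤ p))
  have hsum1 : ∑ p ∈ P, h p / p ≤
      ∑ p ∈ Icc 1 w with p.Prime ∧ ¬ p ∣ q, g p / p + 4 := by
    refine (sum_le_sum hhp).trans ?_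
    rw [sum_add_distrib, ← mul_sum, ← sum_filter]
    have h1 : P.filter (· ≤ w) = {p ∈ Icc 1 w | p.Prime ∧ ¬ p ∣ q} := by
      ext p
      simp only [hP, mem_filter, mem_Icc]
      constructor
      · tauto
      · rintro ⟨⟨h1, h2⟩, h3⟩
        exact ⟨⟨⟨h1, h2.trans (Nat.le_self_pow two_ne_zero w)⟩, h3⟩, h2⟩
    rw [h1]
    have h2 : (Real.log w)⁻¹ * ∑ p ∈ P, Real.log p / p ≤ (Real.log w)⁻¹ * (4 * Real.log w) := by
      gcongr
    have h3 : (Real.log w)⁻¹ * (4 * Real.log w) = 4 := by field_simp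
    linarith
  have hfin := sum_le_sum hsplit
  rw [sum_add_distrib, ← mul_sum] at hfin
  have h5 : 2 ^ K * Real.exp (2 * c) * α * ∑ p ∈ P, Real.log p / p ≤
      2 ^ K * Real.exp (2 * c) * (4 * c) := by
    calc _ ≤ 2 ^ K * Real.exp (2 * c) * α * (4 * Real.log w) := by gcongr
      _ = 2 ^ K * Real.exp (2 * c) * (4 * (α * Real.log w)) := by ring
      _ ≤ _ := by gcongr
  linarith

/-! ### Functions of the class `C_k` are of divisor type -/

lemma log_mul_eq_sum_of_memCkWith {k : ℝ} {f Λf : ℕ → ℂ} (h : MemCkWith k f Λf) {n : ℕ}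
    (hn : n ≠ 0) :
    (Real.log n : ℂ) * f n = ∑ d ∈ n.divisorsAntidiagonal, f d.1 * Λf d.2 := by
  obtain ⟨-, -, hf, -, hL, -, hd⟩ := h
  have hfs : ∀ s : ℂ, 1 < s.re → LSeriesSummable f s := fun s hs => (hf s hs).of_norm
  have hLs : ∀ s : ℂ, 1 < s.re → LSeriesSummable Λf s := fun s hs => (hL s hs).of_norm
  have hab : LSeries.abscissaOfAbsConv f ≤ (1 : ℝ) :=
    LSeries.abscissaOfAbsConv_le_of_forall_lt_LSeriesSummable fun y hy => hfs y (by simpa using hy)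
  have hcs : LSeries.abscissaOfAbsConv (LSeries.convolution f Λf) ≤ (1 : ℝ) :=
    LSeries.abscissaOfAbsConv_le_of_forall_lt_LSeriesSummable fun y hy =>
      (hfs y (by simpa using hy)).convolution (hLs y (by simpa using hy))
  have key := LSeries.eq_of_LSeries_eventually_eq (f := LSeries.logMul f)
    (g := LSeries.convolution f Λf)
    (by rw [LSeries.abscissaOfAbsConv_logMul]; exact hab.trans_lt (EReal.coe_lt_top 1))
    (hcs.trans_lt (EReal.coe_lt_top 1)) (by
      filter_upwards [Filter.eventually_gt_atTop (1 : ℝ)] with y hy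
      have hy1 : 1 < (y : ℂ).re := by simpa using hy
      have h1 := LSeries_hasDerivAt (f := f) (s := (y : ℂ))
        (hab.trans_lt (by exact_mod_cast hy1))
      have h2 := h1.unique (hd y hy1)
      rw [LSeries_convolution' (hfs y hy1) (hLs y hy1)]
      exact neg_injective h2) hn
  rw [LSeries.convolution_def] at key
  refine Eq.trans ?_ key
  simp [LSeries.logMul, Complex.natCast_log]

lemma mul_norm_prime_pow_le {k : ℝ} {f Λf : ℕ → ℂ} (h : MemCkWith k f Λf) {p : ℕ}
    (hp : p.Prime) (e : ℕ) :
    (e : ℝ) * ‖f (p ^ e)‖ ≤ k * ∑ i ∈ range e, ‖f (p ^ i)‖ := by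
  have hlog : 0 < Real.log p := Real.log_pos (by exact_mod_cast hp.one_lt)
  have hkey := congrArg norm (log_mul_eq_sum_of_memCkWith h (pow_ne_zero e hp.ne_zero))
  have hΛ := h.2.1
  rw [Nat.sum_divisorsAntidiagonal (f := fun i j => f i * Λf j), Nat.sum_divisors_prime_pow hp,
    sum_range_succ, Nat.div_self (pow_pos hp.pos e)] at hkey
  have h1 : Λf 1 = 0 := by simpa using hΛ 1
  rw [h1, mul_zero, add_zero, norm_mul, Complex.norm_real, Nat.cast_pow, Real.log_pow,
    Real.norm_of_nonneg (by positivity)] at hkey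
  have hle : ‖∑ i ∈ range e, f (p ^ i) * Λf (p ^ e / p ^ i)‖ ≤
      ∑ i ∈ range e, ‖f (p ^ i)‖ * (k * Real.log p) := by
    refine (norm_sum_le _ _).trans (sum_le_sum fun i hi => ?_)
    have hi' : i < e := mem_range.1 hi
    rw [norm_mul, Nat.pow_div hi'.le hp.pos]
    gcongr
    refine (hΛ _).trans_eq ?_
    rw [ArithmeticFunction.vonMangoldt_apply_pow (by omega),
      ArithmeticFunction.vonMangoldt_apply_prime hp]
  rw [← hkey, ← sum_mul] at hle
  refine le_of_mul_le_mul_left ?_ hlog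
  linarith

lemma mul_pow_le_pow_succ_sub {j : ℝ} (hj : 0 ≤ j) (K : ℕ) :
    ((K : ℝ) + 1) * j ^ K ≤ (j + 1) ^ (K + 1) - j ^ (K + 1) := by
  induction K with
  | zero => simp
  | succ K ih =>
    push_cast
    have h1 := mul_le_mul_of_nonneg_left ih (by linarith : 0 ≤ j + 1)
    have h2 : 0 ≤ ((K : ℝ) + 1) * j ^ K := by positivity
    rw [pow_succ _ (K + 1), pow_succ j (K + 1)]
    have h3 : j ^ (K + 1) = j ^ K * j := pow_succ _ _
    nlinarith

lemma le_pow_of_mul_le_sum {k : ℝ} {K : ℕ} (hk : 0 ≤ k) (hK : 2 * k ≤ K) {u : ℕ → ℝ}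
    (h0 : u 0 ≤ 1) (hu : ∀ e : ℕ, (e : ℝ) * u e ≤ k * ∑ i ∈ range e, u i) (e : ℕ) :
    u e ≤ ((e : ℝ) + 1) ^ K := by
  induction e using Nat.strong_induction_on with
  | _ e ih =>
    rcases Nat.eq_zero_or_pos e with rfl | he
    · simpa using h0
    have he1 : (1 : ℝ) ≤ e := by exact_mod_cast he
    have h1 : ((K : ℝ) + 1) * ∑ i ∈ range e, u i ≤ ((e : ℝ) + 1) ^ (K + 1) := by
      calc _ ≤ ∑ i ∈ range e, ((((i + 1 : ℕ) : ℝ) + 1) ^ (K + 1) - ((i : ℝ) + 1) ^ (K + 1)) := by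
            rw [mul_sum]
            refine sum_le_sum fun i hi => ?_
            have h2 := mul_pow_le_pow_succ_sub (j := (i : ℝ) + 1) (by positivity) K
            push_cast
            refine le_trans ?_ h2
            gcongr
            exact ih i (mem_range.1 hi)
        _ = ((e : ℝ) + 1) ^ (K + 1) - 1 := by
            rw [sum_range_sub (fun i : ℕ => ((i : ℝ) + 1) ^ (K + 1))]
            simp
        _ ≤ _ := by linarith
    have hK1 : (0 : ℝ) < K + 1 := by positivity
    have hpos : 0 < ((e : ℝ) + 1) ^ K := by positivity
    have h3 : ((K : ℝ) + 1) * (e * u e) ≤ ((K : ℝ) + 1) * (e * ((e : ℝ) + 1) ^ K) := by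
      calc ((K : ℝ) + 1) * (e * u e) ≤ ((K : ℝ) + 1) * (k * ∑ i ∈ range e, u i) :=
            mul_le_mul_of_nonneg_left (hu e) hK1.le
        _ = k * (((K : ℝ) + 1) * ∑ i ∈ range e, u i) := by ring
        _ ≤ k * ((e : ℝ) + 1) ^ (K + 1) := by gcongr
        _ = k * (e + 1) * ((e : ℝ) + 1) ^ K := by ring
        _ ≤ (((K : ℝ) + 1) * e) * ((e : ℝ) + 1) ^ K := by
            refine mul_le_mul_of_nonneg_right ?_ hpos.le
            nlinarith
        _ = _ := by ring
    exact le_of_mul_le_mul_left (le_of_mul_le_mul_left h3 hK1) (by linarith)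

lemma isDivisorBounded_of_memCk {k : ℝ} (hk : 0 < k) {f : ℕ → ℂ} (h : MemCk k f) :
    IsDivisorBounded ⌈2 * k⌉₊ fun n => ‖f n‖ := by
  obtain ⟨Λf, h⟩ := h
  refine ⟨fun n => norm_nonneg _, by simp [h.1.1], fun m n hmn => by simp [h.1.2 m n hmn],
    fun p e hp => ?_⟩
  exact le_pow_of_mul_le_sum (u := fun e => ‖f (p ^ e)‖) hk.le (Nat.le_ceil _) (by simp [h.1.1])
    (mul_norm_prime_pow_le h hp) e

/-! ### Pointwise bounds -/

namespace IsDivisorBounded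

variable {K : ℕ} {g : ℕ → ℝ}

lemma eq_factorization_prod (hg : IsDivisorBounded K g) {n : ℕ} (hn : n ≠ 0) :
    g n = ∏ p ∈ n.primeFactors, g (p ^ n.factorization p) :=
  Nat.multiplicative_factorization g hg.map_mul hg.map_one hn

/-- A `w`-rough integer at most `w ^ t` has at most `t` prime factors, each contributing a factor
at most `2 ^ K`. -/
lemma le_of_rough (hg : IsDivisorBounded K g) {w d t : ℕ} (hw : 2 ≤ w) (hd0 : d ≠ 0)
    (hd : ∀ p, p.Prime → p ∣ d → w < p) (hdt : d ≤ w ^ t) : g d ≤ (2 ^ K) ^ t := by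
  have hsum : ∑ p ∈ d.primeFactors, d.factorization p ≤ t := by
    refine (Nat.pow_le_pow_iff_right (by omega : 1 < w)).1 (le_trans ?_ hdt)
    conv_rhs => rw [← Nat.prod_factorization_pow_eq_self hd0]
    rw [← prod_pow_eq_pow_sum]
    exact prod_le_prod' fun p hp => Nat.pow_le_pow_left
      (hd p (Nat.prime_of_mem_primeFactors hp) (Nat.dvd_of_mem_primeFactors hp)).le _
  calc g d = ∏ p ∈ d.primeFactors, g (p ^ d.factorization p) := hg.eq_factorization_prod hd0
    _ ≤ ∏ p ∈ d.primeFactors, ((2 : ℝ) ^ K) ^ d.factorization p := by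
        refine prod_le_prod (fun p _ => hg.nonneg _) fun p hp => ?_
        refine (hg.prime_pow_le p _ (Nat.prime_of_mem_primeFactors hp)).trans ?_
        rw [← pow_mul, mul_comm, pow_mul]
        gcongr
        exact_mod_cast (Nat.lt_two_pow_self (n := d.factorization p))
    _ = ((2 : ℝ) ^ K) ^ ∑ p ∈ d.primeFactors, d.factorization p := prod_pow_eq_pow_sum _ _ _
    _ ≤ _ := pow_le_pow_right₀ (one_le_pow₀ one_le_two) hsum

end IsDivisorBounded

lemma exists_add_one_pow_le (K : ℕ) {δ : ℝ} (hδ : 0 < δ) :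
    ∃ B : ℝ, 1 ≤ B ∧ ∀ p e : ℕ, 2 ≤ p → ((e : ℝ) + 1) ^ K ≤ B * ((p : ℝ) ^ δ) ^ e := by
  set r : ℝ := (2 : ℝ) ^ (-δ) with hr
  have hr0 : 0 < r := by positivity
  have hr1 : r < 1 := Real.rpow_lt_one_of_one_lt_of_neg (by norm_num) (by linarith)
  have hs := summable_add_pow_mul_geometric K 1 hr0 hr1
  have hnn : ∀ e : ℕ, 0 ≤ ((e : ℝ) + (1 : ℕ)) ^ K * r ^ e := fun e => by positivity
  refine ⟨∑' e : ℕ, ((e : ℝ) + (1 : ℕ)) ^ K * r ^ e, ?_, fun p e hp => ?_⟩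
  · simpa using hs.le_tsum 0 fun e _ => hnn e
  · have h1 := hs.le_tsum e fun e _ => hnn e
    have hp2 : (2 : ℝ) ^ δ ≤ (p : ℝ) ^ δ :=
      Real.rpow_le_rpow (by norm_num) (by exact_mod_cast hp) hδ.le
    have hrp : 1 ≤ r * (p : ℝ) ^ δ := by
      calc (1 : ℝ) = r * 2 ^ δ := by rw [hr, ← Real.rpow_add (by norm_num)]; simp
        _ ≤ _ := by gcongr
    calc ((e : ℝ) + 1) ^ K ≤ ((e : ℝ) + 1) ^ K * (r * (p : ℝ) ^ δ) ^ e :=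
          le_mul_of_one_le_right (by positivity) (one_le_pow₀ hrp)
      _ = (((e : ℝ) + (1 : ℕ)) ^ K * r ^ e) * ((p : ℝ) ^ δ) ^ e := by
          rw [mul_pow]; push_cast; ring
      _ ≤ _ := by gcongr

/-- The divisor bound. -/
lemma exists_le_mul_rpow (K : ℕ) {δ : ℝ} (hδ : 0 < δ) :
    ∃ C : ℝ, 1 ≤ C ∧ ∀ g : ℕ → ℝ, IsDivisorBounded K g → ∀ n : ℕ, n ≠ 0 →
      g n ≤ C * (n : ℝ) ^ δ := by
  obtain ⟨B, hB1, hB⟩ := exists_add_one_pow_le K hδ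
  set T : ℕ := ⌈((2 : ℝ) ^ K) ^ (1 / δ)⌉₊ with hT
  refine ⟨B ^ T, one_le_pow₀ hB1, fun g hg n hn => ?_⟩
  have hterm : ∀ p ∈ n.primeFactors, g (p ^ n.factorization p) ≤
      (if p ≤ T then B else 1) * ((p : ℝ) ^ δ) ^ n.factorization p := by
    intro p hp
    have hpp := Nat.prime_of_mem_primeFactors hp
    refine (hg.prime_pow_le p _ hpp).trans ?_
    split_ifs with hpT
    · exact hB p _ hpp.two_le
    · rw [one_mul]
      have h2 : (2 : ℝ) ^ K ≤ (p : ℝ) ^ δ := by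
        have h3 : ((2 : ℝ) ^ K) ^ (1 / δ) ≤ p :=
          (Nat.le_ceil _).trans (Nat.cast_le.2 (by omega : T ≤ p))
        calc (2 : ℝ) ^ K = (((2 : ℝ) ^ K) ^ (1 / δ)) ^ δ := by
              rw [← Real.rpow_mul (by positivity), one_div_mul_cancel hδ.ne', Real.rpow_one]
          _ ≤ _ := Real.rpow_le_rpow (by positivity) h3 hδ.le
      calc (((n.factorization p : ℕ) : ℝ) + 1) ^ K ≤ ((2 : ℝ) ^ n.factorization p) ^ K := by
            gcongr
            exact_mod_cast (Nat.lt_two_pow_self (n := n.factorization p))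
        _ = ((2 : ℝ) ^ K) ^ n.factorization p := by rw [← pow_mul, mul_comm, pow_mul]
        _ ≤ _ := by gcongr
  have hcard : #{p ∈ n.primeFactors | p ≤ T} ≤ T := by
    calc #{p ∈ n.primeFactors | p ≤ T} ≤ #(Icc 1 T) := card_le_card fun p hp => by
          obtain ⟨h1, h2⟩ := mem_filter.1 hp
          exact mem_Icc.2 ⟨(Nat.prime_of_mem_primeFactors h1).one_le, h2⟩
      _ = T := by simp
  rw [hg.eq_factorization_prod hn]
  refine (prod_le_prod (fun p _ => hg.nonneg _) hterm).trans ?_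
  rw [prod_mul_distrib, prod_ite, prod_const, prod_const_one, mul_one]
  have hnδ : ∏ p ∈ n.primeFactors, ((p : ℝ) ^ δ) ^ n.factorization p = (n : ℝ) ^ δ := by
    have h1 : (n : ℝ) = ∏ p ∈ n.primeFactors, (p : ℝ) ^ n.factorization p := by
      conv_lhs => rw [← Nat.prod_factorization_pow_eq_self hn]
      rw [Finsupp.prod, Nat.support_factorization]
      push_cast
      rfl
    rw [h1, ← Real.finsetProd_rpow _ _ fun p _ => by positivity]
    refine prod_congr rfl fun p _ => ?_
    rw [← Real.rpow_natCast, ← Real.rpow_natCast, ← Real.rpow_mul (by positivity),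
      ← Real.rpow_mul (by positivity), mul_comm]
  rw [hnδ]
  gcongr

/-! ### The contribution of integers with a prescribed medium divisor -/

lemma coprime_of_modEq_of_dvd {n m a q : ℕ} (ha : a.Coprime q) (hn : n ≡ a [MOD q])
    (hm : m ∣ n) : m.Coprime q := by
  have h : n.Coprime q := by rw [Nat.Coprime, hn.gcd_eq]; exact ha
  exact h.coprime_dvd_left hm

lemma sum_le_sum_mul_card {T M : Finset ℕ} {P : ℕ → ℕ → Prop} [∀ m n, Decidable (P m n)]
    {g v : ℕ → ℝ} (hv : ∀ m, 0 ≤ v m)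
    (hT : ∀ n ∈ T, ∃ m ∈ M, P m n ∧ g n ≤ v m) :
    ∑ n ∈ T, g n ≤ ∑ m ∈ M, v m * (#{n ∈ T | P m n} : ℝ) := by
  have h1 : ∀ n ∈ T, g n ≤ ∑ m ∈ M, if P m n then v m else 0 := by
    intro n hn
    obtain ⟨m, hm, hP, hle⟩ := hT n hn
    refine hle.trans ?_
    have := single_le_sum (f := fun m => if P m n then v m else 0)
      (fun i _ => by split_ifs <;> simp [hv]) hm
    simpa [hP] using this
  refine (sum_le_sum h1).trans_eq ?_
  rw [sum_comm]
  refine sum_congr rfl fun m _ => ?_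
  rw [← sum_filter, sum_const, nsmul_eq_mul, mul_comm]

lemma IsDivisorBounded.le_mul_smoothPart {K : ℕ} {g : ℕ → ℝ} (hg : IsDivisorBounded K g)
    {w n t : ℕ} (hw : 2 ≤ w) (hn : n ≠ 0) (hnt : n ≤ w ^ t) :
    g n ≤ (2 ^ K) ^ t * g (smoothPart w n) := by
  have hmul := smoothPart_mul_roughPart w hn
  have hr0 : roughPart w n ≠ 0 := right_ne_zero_of_mul (hmul.symm ▸ hn)
  have hle : roughPart w n ≤ n := Nat.le_of_dvd (Nat.pos_of_ne_zero hn) (Dvd.intro_left _ hmul)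
  have hco : (smoothPart w n).Coprime (roughPart w n) :=
    coprime_of_smooth_of_rough (fun p hp => le_of_prime_dvd_smoothPart hp)
      (fun p hp => lt_of_prime_dvd_roughPart hp)
  have h1 := hg.map_mul _ _ hco
  rw [hmul] at h1
  rw [h1, mul_comm]
  exact mul_le_mul_of_nonneg_right (hg.le_of_rough hw hr0
    (fun p hp => lt_of_prime_dvd_roughPart hp) (hle.trans hnt)) (hg.nonneg _)

lemma inv_le_inv_mul_rpow {m : ℕ} (hm : m ≠ 0) {α Y : ℝ} (hY : 0 < Y) (h : Y ≤ (m : ℝ) ^ α) :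
    (m : ℝ)⁻¹ ≤ Y⁻¹ * (m : ℝ) ^ (α - 1) := by
  have hm0 : (0 : ℝ) < m := by exact_mod_cast Nat.pos_of_ne_zero hm
  rw [Real.rpow_sub hm0, Real.rpow_one]
  calc (m : ℝ)⁻¹ = Y⁻¹ * (Y / m) := by field_simp
    _ ≤ _ := by gcongr

/-- Sieve bound, averaged over the medium divisors `m ≤ y ^ 2` by the Rankin method. -/
theorem sum_rough_cofactor_le (K : ℕ) (c : ℝ) : ∃ C : ℝ, 0 < C ∧
    ∀ (g : ℕ → ℝ), IsDivisorBounded K g → ∀ (A N q a w t y : ℕ) (α Y : ℝ) (T : Finset ℕ),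
    0 < q → a.Coprime q → 2 ≤ w → w ≤ y → A + q * y ^ 7 ≤ N →
    0 ≤ α → α ≤ 1 / 4 → α * Real.log w ≤ c → 0 < Y →
    (∀ n ∈ T, n ∈ Ioc A N ∧ n ≡ a [MOD q] ∧ n ≤ w ^ t ∧
      ∃ m, m ∣ n ∧ m ≤ y ^ 2 ∧ (∀ p, p.Prime → p ∣ m → p ≤ w ^ 2) ∧
        (∀ p, p.Prime → p ∣ n / m → w < p) ∧ Y ≤ (m : ℝ) ^ α) →
    ∑ n ∈ T, g n ≤ C * (2 ^ K) ^ t * (((N : ℝ) - A) / (q.totient * Real.log w)) * Y⁻¹ *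
      Real.exp (∑ p ∈ Icc 1 w with p.Prime ∧ ¬ p ∣ q, g p / p) := by
  classical
  obtain ⟨C, hC0, hC⟩ := sum_smoothPart_rpow_le K c
  refine ⟨2 * C, by positivity, ?_⟩
  intro g hg A N q a w t y α Y T hq ha hw hwy hN hα0 hα hαc hY hT
  have hlogw : 0 < Real.log w := Real.log_pos (by exact_mod_cast hw)
  have hφ : (0 : ℝ) < q.totient := by exact_mod_cast Nat.totient_pos.2 hq
  have hAN : A ≤ N := by omega
  have hH : (q : ℝ) * (y : ℝ) ^ 7 ≤ (N : ℝ) - A := by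
    have : ((A + q * y ^ 7 : ℕ) : ℝ) ≤ N := by exact_mod_cast hN
    push_cast at this
    linarith
  have hy0 : (0 : ℝ) < y := by exact_mod_cast (by omega : 0 < y)
  have hH0 : 0 ≤ (N : ℝ) - A := le_trans (by positivity) hH
  set M : Finset ℕ := {m ∈ Icc 1 (y ^ 2) | m.Coprime q ∧ (∀ p, p.Prime → p ∣ m → p ≤ w ^ 2) ∧
    Y ≤ (m : ℝ) ^ α} with hM
  set P : ℕ → ℕ → Prop := fun m n => m ∣ n ∧ ∀ p ≤ w, p.Prime → ¬ p ∣ n / m with hP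
  have hstep := sum_le_sum_mul_card (T := T) (M := M) (P := P) (g := g)
    (v := fun m => (2 ^ K) ^ t * g (smoothPart w m))
    (fun m => mul_nonneg (by positivity) (hg.nonneg _)) (by
      intro n hn
      obtain ⟨hn1, hn2, hn3, m, hmn, hmy, hmw, hr, hYm⟩ := hT n hn
      have hn0 : n ≠ 0 := by have := (mem_Ioc.1 hn1).1; omega
      have hm0 : m ≠ 0 := fun h => hn0 (by simpa [h] using hmn)
      have hq0 : n / m ≠ 0 := fun h => hn0 (by rw [← Nat.mul_div_cancel' hmn, h, mul_zero])
      refine ⟨m, mem_filter.2 ⟨mem_Icc.2 ⟨Nat.pos_of_ne_zero hm0, hmy⟩,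
        coprime_of_modEq_of_dvd ha hn2 hmn, hmw, hYm⟩,
        ⟨hmn, fun p hpw hp hpd => (hr p hp hpd).not_ge hpw⟩, ?_⟩
      have hs : smoothPart w n = smoothPart w m := by
        conv_lhs => rw [← Nat.mul_div_cancel' hmn, smoothPart_mul w hm0 hq0,
          smoothPart_eq_one hq0 hr, mul_one]
      rw [← hs]
      exact hg.le_mul_smoothPart hw hn0 hn3)
  refine hstep.trans ?_
  have hcount : ∀ m ∈ M, (#{n ∈ T | P m n} : ℝ) ≤
      2 * (((N : ℝ) - A) / (q.totient * Real.log w)) * (Y⁻¹ * (m : ℝ) ^ (α - 1)) := by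
    intro m hm
    obtain ⟨hm1, hmq, -, hmY⟩ := mem_filter.1 hm
    obtain ⟨hm0, hmy⟩ := mem_Icc.1 hm1
    have hm0' : (0 : ℝ) < m := by exact_mod_cast hm0
    have hsub : (#{n ∈ T | P m n} : ℝ) ≤
        (#{n ∈ Ioc A N | n ≡ a [MOD q] ∧ m ∣ n ∧ ∀ p ≤ w, p.Prime → ¬ p ∣ n / m} : ℝ) := by
      refine Nat.cast_le.2 (card_le_card fun n hn => ?_)
      obtain ⟨hnT, hnP⟩ := mem_filter.1 hn
      obtain ⟨hn1, hn2, -⟩ := hT n hnT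
      exact mem_filter.2 ⟨hn1, hn2, hnP.1, hnP.2⟩
    have hsv := card_rough_le (a := a) hAN hq hm0 hmq hw
    have herr : (w : ℝ) ^ 4 ≤ ((N : ℝ) - A) / (q.totient * m * Real.log w) := by
      rw [le_div_iff₀ (by positivity)]
      have hlw : Real.log w ≤ y :=
        (Real.log_le_self (by positivity)).trans (by exact_mod_cast hwy)
      have hmy' : (m : ℝ) ≤ (y : ℝ) ^ 2 := by exact_mod_cast hmy
      have hwy' : (w : ℝ) ≤ y := by exact_mod_cast hwy
      have hφq : (q.totient : ℝ) ≤ q := by exact_mod_cast Nat.totient_le q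
      calc (w : ℝ) ^ 4 * (q.totient * m * Real.log w) ≤
            (y : ℝ) ^ 4 * (q * (y : ℝ) ^ 2 * y) := by gcongr
        _ = q * (y : ℝ) ^ 7 := by ring
        _ ≤ _ := hH
    calc (#{n ∈ T | P m n} : ℝ) ≤ 2 * (((N : ℝ) - A) / (q.totient * m * Real.log w)) := by
          linarith
      _ = 2 * (((N : ℝ) - A) / (q.totient * Real.log w)) * (m : ℝ)⁻¹ := by
          field_simp
      _ ≤ _ := by
          gcongr
          exact inv_le_inv_mul_rpow (by omega) hY hmY
  have hR := hC g hg α w q M hα0 hα hw hαc (fun m hm => by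
    obtain ⟨hm1, hmq, hmw, -⟩ := mem_filter.1 hm
    have := (mem_Icc.1 hm1).1
    refine ⟨by omega, fun p hp hpm => ⟨hmw p hp hpm, fun hpq => ?_⟩⟩
    exact hp.one_lt.ne' (Nat.dvd_one.1 (hmq ▸ Nat.dvd_gcd hpm hpq)))
  calc ∑ m ∈ M, (2 ^ K) ^ t * g (smoothPart w m) * (#{n ∈ T | P m n} : ℝ)
      ≤ ∑ m ∈ M, (2 ^ K) ^ t * g (smoothPart w m) *
        (2 * (((N : ℝ) - A) / (q.totient * Real.log w)) * (Y⁻¹ * (m : ℝ) ^ (α - 1))) :=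
        sum_le_sum fun m hm => mul_le_mul_of_nonneg_left (hcount m hm)
          (mul_nonneg (by positivity) (hg.nonneg _))
    _ = (2 ^ K) ^ t * (2 * (((N : ℝ) - A) / (q.totient * Real.log w))) * Y⁻¹ *
        ∑ m ∈ M, g (smoothPart w m) * (m : ℝ) ^ (α - 1) := by
        rw [mul_sum]
        exact sum_congr rfl fun m _ => by ring
    _ ≤ (2 ^ K) ^ t * (2 * (((N : ℝ) - A) / (q.totient * Real.log w))) * Y⁻¹ *
        (C * Real.exp (∑ p ∈ Icc 1 w with p.Prime ∧ ¬ p ∣ q, g p / p)) :=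
        mul_le_mul_of_nonneg_left hR (by positivity)
    _ = _ := by ring

/-- Integers whose `w`-smooth part is large contribute little. -/
theorem sum_large_smoothPart_le (K L w : ℕ) (hw : 2 ≤ w) : ∃ C : ℝ, 0 < C ∧
    ∀ (g : ℕ → ℝ), IsDivisorBounded K g → ∀ (A N q a y : ℕ) (T : Finset ℕ),
    0 < q → a.Coprime q → w ≤ y → A + q * y ^ 7 ≤ N → N ≤ y ^ L →
    (∀ n ∈ T, n ∈ Ioc A N ∧ n ≡ a [MOD q] ∧ y < smoothPart w n) →
    ∑ n ∈ T, g n ≤ C * (((N : ℝ) - A) / (q.totient * Real.log y)) := by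
  classical
  set δ : ℝ := 1 / (8 * (L + 1)) with hδ
  have hδ0 : 0 < δ := by positivity
  obtain ⟨C₁, hC₁, hbd⟩ := exists_le_mul_rpow K hδ0
  obtain ⟨C₂, hC₂, hRk⟩ := sum_smoothPart_rpow_le 0 (1 / 4 * Real.log w)
  set E : ℝ := Real.exp (∑ p ∈ Icc 1 w with p.Prime, 1 / (p : ℝ)) with hE
  have hE0 : 0 < E := Real.exp_pos _
  refine ⟨C₁ * (2 * (8 * (C₂ * E))), by positivity, ?_⟩
  intro g hg A N q a y T hq ha hwy hN hNL hT
  have hφ : (0 : ℝ) < q.totient := by exact_mod_cast Nat.totient_pos.2 hq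
  have hq0 : (0 : ℝ) < q := by exact_mod_cast hq
  have hAN : A ≤ N := by omega
  have hy1 : (1 : ℝ) < y := by exact_mod_cast (by omega : 1 < y)
  have hy0 : (0 : ℝ) < y := by linarith
  have hlogy : 0 < Real.log y := Real.log_pos hy1
  have hH : (q : ℝ) * (y : ℝ) ^ 7 ≤ (N : ℝ) - A := by
    have : ((A + q * y ^ 7 : ℕ) : ℝ) ≤ N := by exact_mod_cast hN
    push_cast at this
    linarith
  have hH0 : 0 ≤ (N : ℝ) - A := le_trans (by positivity) hH
  set Y : ℝ := (y : ℝ) ^ (1 / 4 : ℝ) with hY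
  have hY0 : 0 < Y := by positivity
  set M : Finset ℕ := {m ∈ Icc 1 (y ^ 2) | m.Coprime q ∧ (∀ p, p.Prime → p ∣ m → p ≤ w) ∧
    Y ≤ (m : ℝ) ^ (1 / 4 : ℝ)} with hM
  have hstep := sum_le_sum_mul_card (T := T) (M := M) (P := fun m n => m ∣ n) (g := g)
    (v := fun _ => C₁ * (y : ℝ) ^ (1 / 8 : ℝ)) (fun m => by positivity) (by
      intro n hn
      obtain ⟨hn1, hn2, hn3⟩ := hT n hn
      have hn0 : n ≠ 0 := by have := (mem_Ioc.1 hn1).1; omega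
      obtain ⟨m, -, hms, hym, hmy⟩ := exists_medium_divisor (one_dvd (smoothPart w n))
        (by omega : 1 ≤ y) hn3 (W := w) (fun p hp h => le_of_prime_dvd_smoothPart hp h)
      have hmn : m ∣ n := hms.trans (smoothPart_dvd w hn0)
      refine ⟨m, mem_filter.2 ⟨mem_Icc.2 ⟨by omega, hmy.trans ?_⟩,
        coprime_of_modEq_of_dvd ha hn2 hmn,
        fun p hp hpm => le_of_prime_dvd_smoothPart hp (hpm.trans hms), ?_⟩, hmn, ?_⟩
      · rw [sq]
        exact Nat.mul_le_mul_left y hwy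
      · exact Real.rpow_le_rpow hy0.le (by exact_mod_cast hym.le) (by norm_num)
      · refine (hbd g hg n hn0).trans ?_
        have h1 : (n : ℝ) ≤ (y : ℝ) ^ L := by
          exact_mod_cast (mem_Ioc.1 hn1).2.trans hNL
        have h2 : (n : ℝ) ^ δ ≤ (y : ℝ) ^ (1 / 8 : ℝ) := by
          calc (n : ℝ) ^ δ ≤ ((y : ℝ) ^ L) ^ δ := Real.rpow_le_rpow (by positivity) h1 hδ0.le
            _ = (y : ℝ) ^ ((L : ℝ) * δ) := by
                rw [← Real.rpow_natCast, ← Real.rpow_mul hy0.le]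
            _ ≤ _ := Real.rpow_le_rpow_of_exponent_le hy1.le (by
                rw [hδ, mul_one_div, div_le_div_iff₀ (by positivity) (by norm_num)]
                linarith)
        gcongr)
  refine hstep.trans ?_
  have hcount : ∀ m ∈ M, (#{n ∈ T | m ∣ n} : ℝ) ≤
      2 * (((N : ℝ) - A) / q) * (Y⁻¹ * (m : ℝ) ^ (1 / 4 - 1 : ℝ)) := by
    intro m hm
    obtain ⟨hm1, hmq, -, hmY⟩ := mem_filter.1 hm
    obtain ⟨hm0, hmy⟩ := mem_Icc.1 hm1
    have hm0' : (0 : ℝ) < m := by exact_mod_cast hm0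
    have hsub : (#{n ∈ T | m ∣ n} : ℝ) ≤ (#{n ∈ Ioc A N | n ≡ a [MOD q] ∧ m ∣ n} : ℝ) := by
      refine Nat.cast_le.2 (card_le_card fun n hn => ?_)
      obtain ⟨hnT, hnP⟩ := mem_filter.1 hn
      obtain ⟨hn1, hn2, -⟩ := hT n hnT
      exact mem_filter.2 ⟨hn1, hn2, hnP⟩
    have hsv := (abs_le.1 (abs_card_Ioc_modEq_dvd_sub_le (a := a) hAN hq hm0 hmq)).2
    have herr : (1 : ℝ) ≤ ((N : ℝ) - A) / (q * m) := by
      rw [le_div_iff₀ (by positivity), one_mul]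
      have hmy' : (m : ℝ) ≤ (y : ℝ) ^ 2 := by exact_mod_cast hmy
      calc (q : ℝ) * m ≤ q * (y : ℝ) ^ 7 := by
            gcongr
            exact hmy'.trans (pow_le_pow_right₀ hy1.le (by norm_num))
        _ ≤ _ := hH
    calc (#{n ∈ T | m ∣ n} : ℝ) ≤ 2 * (((N : ℝ) - A) / (q * m)) := by linarith
      _ = 2 * (((N : ℝ) - A) / q) * (m : ℝ)⁻¹ := by field_simp
      _ ≤ _ := by
          gcongr
          exact inv_le_inv_mul_rpow (by omega) hY0 hmY
  have hR := hRk (fun _ => 1) IsDivisorBounded.one (1 / 4) w q M (by norm_num) le_rfl hw le_rfl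
    (fun m hm => by
      obtain ⟨hm1, hmq, hmw, -⟩ := mem_filter.1 hm
      have := (mem_Icc.1 hm1).1
      refine ⟨by omega, fun p hp hpm =>
        ⟨(hmw p hp hpm).trans (Nat.le_self_pow two_ne_zero w), fun hpq => ?_⟩⟩
      exact hp.one_lt.ne' (Nat.dvd_one.1 (hmq ▸ Nat.dvd_gcd hpm hpq)))
  have hEle : Real.exp (∑ p ∈ Icc 1 w with p.Prime ∧ ¬ p ∣ q, 1 / (p : ℝ)) ≤ E := by
    refine Real.exp_le_exp.2 (sum_le_sum_of_subset_of_nonneg (fun p hp => ?_)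
      fun p _ _ => by positivity)
    simp only [mem_filter] at hp ⊢
    exact ⟨hp.1, hp.2.1⟩
  have hsum : ∑ m ∈ M, (m : ℝ) ^ (1 / 4 - 1 : ℝ) ≤ C₂ * E := by
    simp only [one_mul] at hR
    exact hR.trans (mul_le_mul_of_nonneg_left hEle hC₂.le)
  have hlog : (y : ℝ) ^ (1 / 8 : ℝ) * Y⁻¹ ≤ 8 * (Real.log y)⁻¹ := by
    have h1 : Real.log y ≤ (y : ℝ) ^ (1 / 8 : ℝ) / (1 / 8) :=
      Real.log_le_rpow_div hy0.le (by norm_num)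
    have h2 : Y = (y : ℝ) ^ (1 / 8 : ℝ) * (y : ℝ) ^ (1 / 8 : ℝ) := by
      rw [hY, ← Real.rpow_add hy0]; norm_num
    have h3 : 0 < (y : ℝ) ^ (1 / 8 : ℝ) := by positivity
    rw [h2, mul_inv, mul_inv_cancel_left₀ h3.ne', ← div_eq_mul_inv, le_div_iff₀ hlogy,
      inv_mul_le_iff₀ h3]
    linarith
  have hφq : ((N : ℝ) - A) / q ≤ ((N : ℝ) - A) / q.totient := by
    gcongr
    exact_mod_cast Nat.totient_le q
  calc ∑ m ∈ M, C₁ * (y : ℝ) ^ (1 / 8 : ℝ) * (#{n ∈ T | m ∣ n} : ℝ)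
      ≤ ∑ m ∈ M, C₁ * (y : ℝ) ^ (1 / 8 : ℝ) *
        (2 * (((N : ℝ) - A) / q) * (Y⁻¹ * (m : ℝ) ^ (1 / 4 - 1 : ℝ))) :=
        sum_le_sum fun m hm => mul_le_mul_of_nonneg_left (hcount m hm) (by positivity)
    _ = C₁ * (2 * (((N : ℝ) - A) / q) * ((y : ℝ) ^ (1 / 8 : ℝ) * Y⁻¹ *
        ∑ m ∈ M, (m : ℝ) ^ (1 / 4 - 1 : ℝ))) := by
        simp only [mul_sum]
        exact sum_congr rfl fun m _ => by ring
    _ ≤ C₁ * (2 * (((N : ℝ) - A) / q.totient) * (8 * (Real.log y)⁻¹ * (C₂ * E))) := by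
        gcongr
    _ = _ := by
        field_simp

/-! ### Summing over dyadic-exponential scales -/

/-- The scales `w_i = 2 ^ (2 ^ i)`, with `w_{i+1} = w_i ^ 2`. -/
def scale (i : ℕ) : ℕ := 2 ^ 2 ^ i

lemma two_le_scale (i : ℕ) : 2 ≤ scale i :=
  Nat.le_self_pow (by positivity) 2

lemma scale_succ (i : ℕ) : scale (i + 1) = scale i ^ 2 := by
  rw [scale, scale, ← pow_mul, pow_succ]

lemma scale_pow_of_le {i I : ℕ} (h : i ≤ I) : scale i ^ 2 ^ (I - i) = scale I := by
  rw [scale, scale, ← pow_mul, ← pow_add, Nat.add_sub_cancel' h]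

lemma scale_mono : Monotone scale := fun _ _ h =>
  Nat.pow_le_pow_right two_pos (Nat.pow_le_pow_right two_pos h)

lemma log_scale (i : ℕ) : Real.log (scale i) = 2 ^ i * Real.log 2 := by
  rw [scale, Nat.cast_pow, Real.log_pow]
  push_cast
  rfl

lemma exists_scale_le {X : ℝ} (hX : 2 ≤ X) :
    ∃ I, (scale I : ℝ) ≤ X ∧ X < (scale (I + 1) : ℝ) := by
  have hM : 2 ≤ ⌊X⌋₊ := Nat.le_floor (by exact_mod_cast hX)
  have hl : Nat.log 2 ⌊X⌋₊ ≠ 0 := (Nat.log_pos one_lt_two hM).ne'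
  refine ⟨Nat.log 2 (Nat.log 2 ⌊X⌋₊), ?_, ?_⟩
  · refine le_trans (Nat.cast_le.2 ?_) (Nat.floor_le (by linarith))
    exact (Nat.pow_le_pow_right two_pos (Nat.pow_log_le_self 2 hl)).trans
      (Nat.pow_log_le_self 2 (by omega))
  · rw [← Nat.floor_lt (by linarith)]
    exact (Nat.lt_pow_succ_log_self one_lt_two _).trans_le
      (Nat.pow_le_pow_right two_pos (Nat.lt_pow_succ_log_self one_lt_two _))

lemma sum_two_pow_div_le (I₀ I : ℕ) : ∑ i ∈ Ico I₀ I, (2 : ℝ) ^ i / 2 ^ I ≤ 1 := by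
  rw [← sum_div, div_le_one (by positivity)]
  calc ∑ i ∈ Ico I₀ I, (2 : ℝ) ^ i ≤ ∑ i ∈ range I, (2 : ℝ) ^ i :=
        sum_le_sum_of_subset_of_nonneg (fun i hi => mem_range.2 (mem_Ico.1 hi).2)
          fun _ _ _ => by positivity
    _ ≤ _ := by
        rw [geom_sum_eq (by norm_num)]
        norm_num

/-- The bound for intervals of length at least `q y ^ 7` ending below `y ^ L`, `y = 2 ^ (2 ^ I)`. -/
theorem sum_modEq_le (K L : ℕ) : ∃ C : ℝ, 0 < C ∧ ∃ I₀ : ℕ,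
    ∀ (g : ℕ → ℝ), IsDivisorBounded K g → ∀ (A N q a I : ℕ),
    0 < q → a.Coprime q → I₀ ≤ I → A + q * scale I ^ 7 ≤ N → N ≤ scale I ^ L →
    ∑ n ∈ Ioc A N with n ≡ a [MOD q], g n ≤
      C * (((N : ℝ) - A) / (q.totient * Real.log (scale I))) *
      Real.exp (∑ p ∈ Icc 1 N with p.Prime ∧ ¬ p ∣ q, g p / p) := by
  classical
  set B : ℝ := (2 ^ K) ^ L with hB
  have hB1 : 1 ≤ B := one_le_pow₀ (one_le_pow₀ one_le_two)
  set c : ℝ := Real.log (4 * B) with hc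
  have hc0 : 0 < c := Real.log_pos (by linarith)
  have hexpc : Real.exp c = 4 * B := Real.exp_log (by linarith)
  obtain ⟨I₀, hI₀⟩ := pow_unbounded_of_one_lt (4 * c / Real.log 2) one_lt_two
  have hlog2 : 0 < Real.log 2 := Real.log_pos one_lt_two
  obtain ⟨C₁, hC₁, hmain⟩ := sum_rough_cofactor_le K c
  obtain ⟨C₂, hC₂, hsmall⟩ := sum_large_smoothPart_le K L (scale I₀) (two_le_scale I₀)
  refine ⟨C₂ + C₁ + C₁ * B, by positivity, I₀, ?_⟩
  intro g hg A N q a I hq ha hI hN hNL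
  set y := scale I with hy
  have hy2 : 2 ≤ y := two_le_scale I
  have hlogy : 0 < Real.log y := Real.log_pos (by exact_mod_cast hy2)
  have hφ : (0 : ℝ) < q.totient := by exact_mod_cast Nat.totient_pos.2 hq
  have hAN : (A : ℝ) ≤ N := by exact_mod_cast (by omega : A ≤ N)
  set Q : ℝ := ((N : ℝ) - A) / (q.totient * Real.log y) with hQ
  have hQ0 : 0 ≤ Q := div_nonneg (by linarith) (by positivity)
  set E : ℝ := Real.exp (∑ p ∈ Icc 1 N with p.Prime ∧ ¬ p ∣ q, g p / p) with hE
  have hgp : ∀ p : ℕ, 0 ≤ g p / p := fun p => div_nonneg (hg.nonneg p) p.cast_nonneg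
  have hE1 : 1 ≤ E := Real.one_le_exp (sum_nonneg fun p _ => hgp p)
  have hyN : y ≤ N := by
    have h1 : y ≤ y ^ 7 := Nat.le_self_pow (by norm_num) y
    nlinarith
  have hElt : ∀ w ≤ y, Real.exp (∑ p ∈ Icc 1 w with p.Prime ∧ ¬ p ∣ q, g p / p) ≤ E := by
    intro w hw
    refine Real.exp_le_exp.2 (sum_le_sum_of_subset_of_nonneg (fun p hp => ?_) fun p _ _ => hgp p)
    simp only [mem_filter, mem_Icc] at hp ⊢
    exact ⟨⟨hp.1.1, hp.1.2.trans (hw.trans hyN)⟩, hp.2⟩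
  set S : Finset ℕ := {n ∈ Ioc A N | n ≡ a [MOD q]} with hS
  have hS0 : ∀ n ∈ S, n ≠ 0 := fun n hn => by
    have := (mem_Ioc.1 (mem_filter.1 hn).1).1
    omega
  let F : ℕ → ℝ := fun i => ∑ n ∈ S with y < smoothPart (scale i) n, g n
  have hbottom : F I₀ ≤ C₂ * Q :=
    hsmall g hg A N q a y _ hq ha (scale_mono hI) hN hNL fun n hn => by
      obtain ⟨h1, h2⟩ := mem_filter.1 hn
      exact ⟨(mem_filter.1 h1).1, (mem_filter.1 h1).2, h2⟩
  have hstep : ∀ i, I₀ ≤ i → i < I → F (i + 1) ≤ F i + C₁ * Q * E * ((2 : ℝ) ^ i / 2 ^ I) := by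
    intro i hi hiI
    set w := scale i with hw
    set r := I - i with hr
    have hwy : w ^ 2 ^ r = y := scale_pow_of_le hiI.le
    have hwpos : (0 : ℝ) < w := by exact_mod_cast (two_pos.trans_le (two_le_scale i))
    have hlogw : 0 < Real.log w := Real.log_pos (by exact_mod_cast two_le_scale i)
    have hlogwy : Real.log y = 2 ^ r * Real.log w := by
      rw [← hwy, Nat.cast_pow, Real.log_pow]
      push_cast
      rfl
    set α : ℝ := c / Real.log w with hα
    have hα0 : 0 ≤ α := by positivity
    have hαw : α * Real.log w = c := div_mul_cancel₀ _ hlogw.ne'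
    have hα4 : α ≤ 1 / 4 := by
      rw [hα, div_le_div_iff₀ hlogw (by norm_num), hw, log_scale]
      have h1 : (2 : ℝ) ^ I₀ ≤ 2 ^ i := pow_le_pow_right₀ one_le_two hi
      rw [div_lt_iff₀ hlog2] at hI₀
      nlinarith
    have hYeq : (y : ℝ) ^ α = (4 * B) ^ 2 ^ r := by
      rw [Real.rpow_def_of_pos (by positivity), hlogwy, ← hexpc, ← Real.exp_nat_mul]
      congr 1
      push_cast
      rw [← hαw]
      ring
    set T : Finset ℕ := {n ∈ S | smoothPart w n ≤ y ∧ y < smoothPart (scale (i + 1)) n} with hT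
    have hFT : F (i + 1) ≤ F i + ∑ n ∈ T, g n := by
      simp only [F]
      rw [← sum_filter_add_sum_filter_not (S.filter fun n => y < smoothPart (scale (i + 1)) n)
        (fun n => y < smoothPart w n)]
      refine add_le_add ?_ ?_
      · refine sum_le_sum_of_subset_of_nonneg (fun n hn => ?_) fun n _ _ => hg.nonneg n
        simp only [mem_filter] at hn ⊢
        exact ⟨hn.1.1, hn.2⟩
      · refine sum_le_sum_of_subset_of_nonneg (fun n hn => ?_) fun n _ _ => hg.nonneg n
        simp only [hT, mem_filter, not_lt] at hn ⊢
        exact ⟨hn.1.1, hn.2, hn.1.2⟩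
    have hbound := hmain g hg A N q a w (2 ^ r * L) y α ((y : ℝ) ^ α) T hq ha (two_le_scale i)
      (scale_mono hiI.le) hN hα0 hα4 hαw.le (by positivity) (by
        intro n hn
        obtain ⟨hnS, hn1, hn2⟩ := mem_filter.1 hn
        obtain ⟨hnI, hnq⟩ := mem_filter.1 hnS
        have hn0 := hS0 n hnS
        refine ⟨hnI, hnq, ?_, ?_⟩
        · rw [pow_mul, hwy]
          exact (mem_Ioc.1 hnI).2.trans hNL
        have hww : w ≤ scale (i + 1) := scale_mono (Nat.le_succ i)
        have hdvd : smoothPart w n ∣ smoothPart (scale (i + 1)) n := by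
          have hco : (smoothPart w n).Coprime (roughPart (scale (i + 1)) n) :=
            coprime_of_smooth_of_rough (w := w) (fun p hp h => le_of_prime_dvd_smoothPart hp h)
              fun p hp h => hww.trans_lt (lt_of_prime_dvd_roughPart hp h)
          refine hco.dvd_of_dvd_mul_right ?_
          rw [smoothPart_mul_roughPart _ hn0]
          exact smoothPart_dvd w hn0
        obtain ⟨m, hbm, hms, hym, hmy⟩ := exists_medium_divisor hdvd hn1 hn2
          (W := scale (i + 1)) fun p hp h => le_of_prime_dvd_smoothPart hp h
        have hmn : m ∣ n := hms.trans (smoothPart_dvd _ hn0)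
        refine ⟨m, hmn, hmy.trans ?_, fun p hp hpm => ?_, fun p hp hpm => ?_, ?_⟩
        · rw [sq]
          exact Nat.mul_le_mul_left y (scale_mono hiI)
        · rw [hw, ← scale_succ]
          exact le_of_prime_dvd_smoothPart hp (hpm.trans hms)
        · refine lt_of_prime_dvd_roughPart (n := n) hp (hpm.trans ?_)
          rw [Nat.div_dvd_iff_dvd_mul hmn (by omega)]
          obtain ⟨t, rfl⟩ := hbm
          conv_lhs => rw [← smoothPart_mul_roughPart w hn0]
          exact mul_dvd_mul_right (dvd_mul_right _ _) _
        · exact Real.rpow_le_rpow (by positivity) (by exact_mod_cast hym.le) hα0)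
    refine hFT.trans (add_le_add le_rfl (hbound.trans ?_))
    have hBpow : ((2 : ℝ) ^ K) ^ (2 ^ r * L) = B ^ 2 ^ r := by
      rw [hB, mul_comm, pow_mul]
    have hQw : ((N : ℝ) - A) / (q.totient * Real.log w) = Q * 2 ^ r := by
      rw [hQ, hlogwy]
      field_simp
    have hB0 : 0 < B := by linarith
    have hfour : B ^ 2 ^ r * ((2 : ℝ) ^ r * ((4 * B) ^ 2 ^ r)⁻¹) ≤ 2 ^ i / 2 ^ I := by
      have h1 : (2 : ℝ) ^ I = 2 ^ i * 2 ^ r := by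
        rw [← pow_add, hr, Nat.add_sub_cancel' hiI.le]
      have h2 : (2 : ℝ) ^ r * 2 ^ r ≤ 4 ^ 2 ^ r := by
        rw [← mul_pow]
        norm_num
        exact pow_le_pow_right₀ (by norm_num) Nat.lt_two_pow_self.le
      rw [h1, mul_pow, mul_inv]
      calc B ^ 2 ^ r * ((2 : ℝ) ^ r * ((4 ^ 2 ^ r)⁻¹ * (B ^ 2 ^ r)⁻¹)) =
            2 ^ r / 4 ^ 2 ^ r := by field_simp
        _ ≤ 1 / 2 ^ r := by
            rw [div_le_div_iff₀ (by positivity) (by positivity)]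
            linarith
        _ = _ := by field_simp
    rw [hBpow, hQw, hYeq]
    calc C₁ * B ^ 2 ^ r * (Q * 2 ^ r) * ((4 * B) ^ 2 ^ r)⁻¹ *
          Real.exp (∑ p ∈ Icc 1 w with p.Prime ∧ ¬ p ∣ q, g p / p)
        ≤ C₁ * B ^ 2 ^ r * (Q * 2 ^ r) * ((4 * B) ^ 2 ^ r)⁻¹ * E := by
          gcongr
          exact hElt w (scale_mono hiI.le)
      _ = C₁ * Q * E * (B ^ 2 ^ r * (2 ^ r * ((4 * B) ^ 2 ^ r)⁻¹)) := by ring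
      _ ≤ _ := by gcongr
  have htel : F I ≤ F I₀ + ∑ i ∈ Ico I₀ I, C₁ * Q * E * ((2 : ℝ) ^ i / 2 ^ I) := by
    have : ∀ j, I₀ ≤ j → j ≤ I →
        F j ≤ F I₀ + ∑ i ∈ Ico I₀ j, C₁ * Q * E * ((2 : ℝ) ^ i / 2 ^ I) := by
      intro j hj
      induction j, hj using Nat.le_induction with
      | base => simp
      | succ j hj ih =>
        intro hjI
        rw [sum_Ico_succ_top hj]
        linarith [hstep j hj hjI, ih (by omega)]
    exact this I hI le_rfl
  have hmid : F I ≤ C₂ * Q + C₁ * Q * E := by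
    rw [← mul_sum] at htel
    have h1 := mul_le_mul_of_nonneg_left (sum_two_pow_div_le I₀ I)
      (by positivity : 0 ≤ C₁ * Q * E)
    linarith
  have htop : ∑ n ∈ S with ¬ y < smoothPart y n, g n ≤ C₁ * B * Q * E := by
    have h1 := hmain g hg A N q a y L y 0 1 {n ∈ S | ¬ y < smoothPart y n} hq ha hy2 le_rfl hN
      le_rfl (by norm_num) (by simpa using hc0.le) one_pos (by
        intro n hn
        obtain ⟨hnS, hn1⟩ := mem_filter.1 hn
        obtain ⟨hnI, hnq⟩ := mem_filter.1 hnS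
        have hn0 := hS0 n hnS
        refine ⟨hnI, hnq, (mem_Ioc.1 hnI).2.trans hNL, smoothPart y n, smoothPart_dvd y hn0,
          (not_lt.1 hn1).trans (Nat.le_self_pow two_ne_zero y),
          fun p hp h => (le_of_prime_dvd_smoothPart hp h).trans (Nat.le_self_pow two_ne_zero y),
          fun p hp h => lt_of_prime_dvd_roughPart (n := n) hp ?_, by simp⟩
        have h2 := smoothPart_mul_roughPart y hn0
        rwa [Nat.div_eq_of_eq_mul_right (Nat.pos_of_ne_zero (smoothPart_ne_zero y n)) h2.symm]
          at h)
    refine h1.trans ?_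
    rw [inv_one, mul_one]
    exact mul_le_mul_of_nonneg_left (hElt y le_rfl) (by positivity)
  rw [← sum_filter_add_sum_filter_not S (fun n => y < smoothPart y n)]
  have hQE : Q ≤ Q * E := le_mul_of_one_le_right hQ0 hE1
  have hC₂Q := mul_le_mul_of_nonneg_left hQE hC₂.le
  have hFI : ∑ n ∈ S with y < smoothPart y n, g n = F I := rfl
  rw [hFI]
  calc _ ≤ C₂ * Q + C₁ * Q * E + C₁ * B * Q * E := add_le_add hmid htop
    _ ≤ C₂ * (Q * E) + C₁ * Q * E + C₁ * B * Q * E := by linarith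
    _ = _ := by ring

end Shiu

/-- Shiu-type bound. Let `k, ε > 0` be fixed. For `x` large, `x^ε ≤ z ≤ x`,
`q ≤ z^{1-ε}`, uniformly for all `f ∈ C_k` and any reduced residue class `a (mod q)`,
`Σ_{x-z ≤ n ≤ x, n ≡ a (q)} |f(n)| ≪_{k,ε} (z/φ(q)) (1/log x) exp(Σ_{p ≤ x, p ∤ q} |f(p)|/p)`. -/
theorem shiu_bound (k ε : ℝ) (hk : 0 < k) (hε : 0 < ε) :
    ∃ C x₀ : ℝ, ∀ (x z : ℝ) (q a : ℕ) (f : ℕ → ℂ),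
      x₀ ≤ x → MemCk k f → x ^ ε ≤ z → z ≤ x → (q : ℝ) ≤ z ^ (1 - ε) → 0 < q →
      Nat.Coprime a q →
      ∑ n ∈ (Finset.Icc 1 ⌊x⌋₊).filter (fun n : ℕ => x - z ≤ (n : ℝ) ∧ n % q = a % q), ‖f n‖
        ≤ C * (z / (Nat.totient q : ℝ)) * (1 / Real.log x) *
            Real.exp (∑ p ∈ (Finset.Icc 1 ⌊x⌋₊).filter (fun p => p.Prime ∧ ¬ p ∣ q),
              ‖f p‖ / (p : ℝ)) := by
  set η : ℝ := ε ^ 2 / 8 with hη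
  have hη0 : 0 < η := by positivity
  set L : ℕ := ⌈2 / η⌉₊ with hL
  obtain ⟨C, hC, I₀, hmain⟩ := Shiu.sum_modEq_le ⌈2 * k⌉₊ L
  refine ⟨2 * C * L, max 2 (max ((2 : ℝ) ^ (1 / ε)) ((Shiu.scale I₀ : ℝ) ^ (1 / η))), ?_⟩
  intro x z q a f hx hf hxz hzx hqz hq ha
  obtain ⟨hx2, hxε, hxη⟩ : 2 ≤ x ∧ (2 : ℝ) ^ (1 / ε) ≤ x ∧
      (Shiu.scale I₀ : ℝ) ^ (1 / η) ≤ x := by simpa using hx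
  have hx0 : 0 < x := by linarith
  have hlogx : 0 < Real.log x := Real.log_pos (by linarith)
  have hz2 : 2 ≤ z := by
    refine le_trans ?_ hxz
    calc (2 : ℝ) = ((2 : ℝ) ^ (1 / ε)) ^ ε := by
          rw [← Real.rpow_mul zero_le_two, one_div_mul_cancel hε.ne', Real.rpow_one]
      _ ≤ x ^ ε := Real.rpow_le_rpow (by positivity) hxε hε.le
  have hz0 : 0 < z := by linarith
  have hI₀x : (Shiu.scale I₀ : ℝ) ≤ x ^ η := by
    calc (Shiu.scale I₀ : ℝ) = ((Shiu.scale I₀ : ℝ) ^ (1 / η)) ^ η := by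
          rw [← Real.rpow_mul (by positivity), one_div_mul_cancel hη0.ne', Real.rpow_one]
      _ ≤ x ^ η := Real.rpow_le_rpow (by positivity) hxη hη0.le
  obtain ⟨I, hIx, hxI⟩ := Shiu.exists_scale_le (X := x ^ η)
    (le_trans (by exact_mod_cast Shiu.two_le_scale I₀) hI₀x)
  have hI₀I : I₀ ≤ I := by
    by_contra hcon
    have h1 : (Shiu.scale (I + 1) : ℝ) ≤ Shiu.scale I₀ :=
      Nat.cast_le.2 (Shiu.scale_mono (by omega))
    linarith
  set y : ℕ := Shiu.scale I with hy
  have hy2 : (2 : ℝ) ≤ y := by exact_mod_cast Shiu.two_le_scale I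
  have hlogy : 0 < Real.log y := Real.log_pos (by linarith)
  have hxy : x ≤ (y : ℝ) ^ L := by
    rw [Shiu.scale_succ, Nat.cast_pow, ← hy] at hxI
    calc x = (x ^ η) ^ (1 / η) := by
          rw [← Real.rpow_mul hx0.le, mul_one_div_cancel hη0.ne', Real.rpow_one]
      _ ≤ ((y : ℝ) ^ 2) ^ (1 / η) := Real.rpow_le_rpow (by positivity) hxI.le (by positivity)
      _ = (y : ℝ) ^ (2 / η) := by
          rw [← Real.rpow_natCast, ← Real.rpow_mul (by positivity)]
          congr 1
          push_cast
          ring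
      _ ≤ (y : ℝ) ^ (L : ℝ) :=
          Real.rpow_le_rpow_of_exponent_le (by linarith) (Nat.le_ceil _)
      _ = (y : ℝ) ^ L := Real.rpow_natCast _ _
  have hlogxy : Real.log x ≤ L * Real.log y := by
    have h1 := Real.log_le_log hx0 hxy
    rwa [Real.log_pow] at h1
  have hqy : (q : ℝ) * (y : ℝ) ^ 7 ≤ z / 2 := by
    have h1 : 2 * (y : ℝ) ^ 7 ≤ z ^ ε := by
      calc 2 * (y : ℝ) ^ 7 ≤ y * (y : ℝ) ^ 7 := by gcongr
        _ = (y : ℝ) ^ 8 := by ring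
        _ ≤ (x ^ η) ^ 8 := by gcongr
        _ = (x ^ ε) ^ ε := by
            rw [← Real.rpow_natCast, ← Real.rpow_mul hx0.le, ← Real.rpow_mul hx0.le, hη]
            congr 1
            push_cast
            ring
        _ ≤ z ^ ε := Real.rpow_le_rpow (by positivity) hxz hε.le
    calc (q : ℝ) * (y : ℝ) ^ 7 ≤ z ^ (1 - ε) * (z ^ ε / 2) := by
          gcongr
          linarith
      _ = z / 2 := by
          rw [mul_div_assoc', ← Real.rpow_add hz0, sub_add_cancel, Real.rpow_one]
  set N : ℕ := ⌊x⌋₊ with hN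
  set A : ℕ := ⌈x - z⌉₊ - 1 with hA
  have hNx : (N : ℝ) ≤ x := Nat.floor_le hx0.le
  have hxN : x < N + 1 := Nat.lt_floor_add_one x
  have hAle : (A : ℝ) ≤ x - z := by
    have h1 := Nat.ceil_lt_add_one (sub_nonneg.2 hzx)
    rcases Nat.eq_zero_or_pos ⌈x - z⌉₊ with h | h
    · rw [hA, h]
      simpa using hzx
    · rw [hA, Nat.cast_sub h]
      push_cast
      linarith
  have hleA : x - z ≤ A + 1 := by
    refine (Nat.le_ceil _).trans ?_
    exact_mod_cast (by omega : ⌈x - z⌉₊ ≤ A + 1)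
  have hlen : A + q * y ^ 7 ≤ N := by
    have h1 : ((A + q * y ^ 7 : ℕ) : ℝ) ≤ N := by
      push_cast
      linarith
    exact_mod_cast h1
  have hNL : N ≤ y ^ L := by
    have h1 : (N : ℝ) ≤ ((y ^ L : ℕ) : ℝ) := by
      push_cast
      linarith
    exact_mod_cast h1
  have hg := Shiu.isDivisorBounded_of_memCk hk hf
  have hbound := hmain _ hg A N q a I hq ha hI₀I hlen hNL
  have hsub : ∑ n ∈ (Finset.Icc 1 N).filter (fun n : ℕ => x - z ≤ (n : ℝ) ∧ n % q = a % q), ‖f n‖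
      ≤ ∑ n ∈ (Finset.Ioc A N).filter (fun n => n ≡ a [MOD q]), ‖f n‖ := by
    refine Finset.sum_le_sum_of_subset_of_nonneg (fun n hn => ?_) fun n _ _ => norm_nonneg _
    simp only [Finset.mem_filter, Finset.mem_Icc, Finset.mem_Ioc] at hn ⊢
    obtain ⟨⟨hn1, hnN⟩, hnz, hnq⟩ := hn
    have h1 : ⌈x - z⌉₊ ≤ n := Nat.ceil_le.2 hnz
    exact ⟨⟨by omega, hnN⟩, hnq⟩
  refine hsub.trans (hbound.trans ?_)
  have hφ : (0 : ℝ) < q.totient := by exact_mod_cast Nat.totient_pos.2 hq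
  refine mul_le_mul_of_nonneg_right ?_ (Real.exp_pos _).le
  calc C * (((N : ℝ) - A) / (q.totient * Real.log y))
      ≤ C * (2 * z / (q.totient * (Real.log x / L))) := by
        have hL0 : (0 : ℝ) < L := by
          by_contra hcon
          have : (L : ℝ) * Real.log y ≤ 0 :=
            mul_nonpos_of_nonpos_of_nonneg (not_lt.1 hcon) hlogy.le
          linarith
        gcongr
        · linarith
        · rwa [div_le_iff₀' hL0]
    _ = 2 * C * L * (z / q.totient) * (1 / Real.log x) := by
        field_simp
end

section
/- The quantity b̂_δ(1) − b̂_δ(0) is a strictly decreasing function of δ on [0, 1/2]. -/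
/-- The 1-periodic function `b_δ`, equal to `i e^{iπθ}` for `δ ≤ θ ≤ 1 - δ` and to
`-e^{(1-(2δ)⁻¹) iπθ}` for `-δ < θ ≤ δ` (extended 1-periodically). -/
noncomputable def bFun (δ θ : ℝ) : ℂ :=
  let u : ℝ := Int.fract (θ + δ) - δ
  if δ ≤ u then Complex.I * Complex.exp (Complex.I * (Real.pi : ℂ) * (u : ℂ))
  else -Complex.exp (((1 - (2 * δ)⁻¹ : ℝ) : ℂ) * Complex.I * (Real.pi : ℂ) * (u : ℂ))

/-- The `j`-th Fourier coefficient of `b_δ`, given by the explicit formula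
`sin(2π(jδ - δ/2 + 1/4)) / ((2j-1)·2π·(jδ - δ/2 + 1/4))`. -/
noncomputable def bHat (δ : ℝ) (j : ℤ) : ℝ :=
  Real.sin (2 * Real.pi * ((j : ℝ) * δ - δ / 2 + 1 / 4)) /
    (((2 * (j : ℝ) - 1)) * (2 * Real.pi) * ((j : ℝ) * δ - δ / 2 + 1 / 4))

open intervalIntegral

theorem integral_cos_mul_const {c : ℝ} (hc : c ≠ 0) :
    ∫ t in (0 : ℝ)..1, Real.cos (t * c) = Real.sin c / c := by
  rw [integral_comp_mul_right Real.cos hc]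
  simp [div_eq_inv_mul]

/-- For `0 ≤ δ < 1/2` the difference of coefficients is a cosine integral with positive weight. -/
theorem bHat_one_sub_bHat_zero {δ : ℝ} (h0 : 0 ≤ δ) (h1 : δ < 1 / 2) :
    bHat δ 1 - bHat δ 0 =
      ∫ t in (0 : ℝ)..1, 2 * Real.cos (t * (Real.pi / 2)) * Real.cos (t * (Real.pi * δ)) := by
  have hp := Real.pi_pos
  have hadd : Real.pi / 2 + Real.pi * δ ≠ 0 := by positivity
  have hsub : Real.pi / 2 - Real.pi * δ ≠ 0 := by
    have : 0 < Real.pi * (1 / 2 - δ) := mul_pos hp (by linarith)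
    linarith
  have hcos : ∀ t : ℝ, 2 * Real.cos (t * (Real.pi / 2)) * Real.cos (t * (Real.pi * δ)) =
      Real.cos (t * (Real.pi / 2 + Real.pi * δ)) + Real.cos (t * (Real.pi / 2 - Real.pi * δ)) := by
    intro t
    rw [mul_add, mul_sub, Real.cos_add, Real.cos_sub]
    ring
  simp_rw [hcos]
  rw [integral_add (Continuous.intervalIntegrable (by fun_prop) _ _)
    (Continuous.intervalIntegrable (by fun_prop) _ _), integral_cos_mul_const hadd,
    integral_cos_mul_const hsub, bHat, bHat, sub_eq_add_neg, ← div_neg]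
  congr 2 <;> (congr 1; push_cast; ring)

theorem cos_mul_pi_div_two_pos {t : ℝ} (h0 : 0 ≤ t) (h1 : t < 1) :
    0 < Real.cos (t * (Real.pi / 2)) :=
  Real.cos_pos_of_mem_Ioo ⟨by nlinarith [Real.pi_pos], by nlinarith [Real.pi_pos]⟩

theorem integral_cos_mul_cos_lt {x y : ℝ} (hx : 0 ≤ x) (hxy : x < y) (hy : y ≤ 1 / 2) :
    ∫ t in (0 : ℝ)..1, 2 * Real.cos (t * (Real.pi / 2)) * Real.cos (t * (Real.pi * y)) <
      ∫ t in (0 : ℝ)..1, 2 * Real.cos (t * (Real.pi / 2)) * Real.cos (t * (Real.pi * x)) := by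
  have hp := Real.pi_pos
  have hlt : ∀ t : ℝ, 0 < t → t ≤ 1 →
      Real.cos (t * (Real.pi * y)) < Real.cos (t * (Real.pi * x)) := by
    intro t ht0 ht1
    apply Real.cos_lt_cos_of_nonneg_of_le_pi (by positivity)
    · have : t * y ≤ 1 := by nlinarith
      nlinarith
    · gcongr
  refine integral_lt_integral_of_continuousOn_of_le_of_exists_lt one_pos
    (by fun_prop) (by fun_prop) (fun t ht => ?_) ⟨1 / 2, by norm_num, ?_⟩
  · rcases ht.2.eq_or_lt with rfl | ht1
    · simp
    · exact mul_le_mul_of_nonneg_left (hlt t ht.1 ht.2).le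
        (by linarith [cos_mul_pi_div_two_pos ht.1.le ht1])
  · exact mul_lt_mul_of_pos_left (hlt _ (by norm_num) (by norm_num))
      (mul_pos two_pos (cos_mul_pi_div_two_pos (by norm_num) (by norm_num)))

/-- With the convention `0 / 0 = 0`, the difference vanishes at `δ = 1/2`. -/
theorem bHat_half_one_sub_bHat_half_zero : bHat (1 / 2) 1 - bHat (1 / 2) 0 = 0 := by
  have h : 2 * Real.pi * (1 / 2 - 1 / 2 / 2 + 1 / 4) = Real.pi := by ring
  have h' : (-(1 / 2 / 2) + 1 / 4 : ℝ) = 0 := by norm_num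
  simp only [bHat, Int.cast_one, Int.cast_zero, one_mul, zero_mul, zero_sub, h, h', Real.sin_pi,
    mul_zero, Real.sin_zero, zero_div, sub_zero]

/-- The quantity `b̂_δ(1) - b̂_δ(0)` is a strictly decreasing function of `δ`
on `[0, 1/2]`. -/
theorem bHat_diff_strictAnti :
    StrictAntiOn (fun δ : ℝ => bHat δ 1 - bHat δ 0) (Set.Icc 0 (1 / 2)) := by
  intro x hx y hy hxy
  have hlt := integral_cos_mul_cos_lt hx.1 hxy hy.2
  dsimp only
  rw [bHat_one_sub_bHat_zero hx.1 (hxy.trans_le hy.2)]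
  rcases hy.2.eq_or_lt with rfl | hy2
  · rw [bHat_half_one_sub_bHat_half_zero]
    refine lt_of_le_of_lt (integral_nonneg zero_le_one fun t _ => ?_) hlt
    rw [mul_one_div, mul_assoc]
    exact mul_nonneg zero_le_two (mul_self_nonneg _)
  · rwa [bHat_one_sub_bHat_zero hy.1 hy2]
end

section
/- Let k > 0, f ∈ C_k, and let 0 ≤ δ ≤ 1/2. Let a be the completely multiplicative function determined by a(p) = b_δ((log p)/(2π)) on primes p. Then the series log G̃(s) = Σ_{n≥2} ( Λ_f(n)/((log n) n^s) ) · ( a(n) − b_δ((log n)/(2π)) ) is absolutely convergent (uniformly) in the half-plane Re(s) ≥ 3/4 and defines an analytic function in the half-plane Re(s) > 1/2. -/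
/-- The prime powers `p ^ j` with `j ≥ 2`. -/
def properPrimePowers : Set ℕ := {n | IsPrimePow n ∧ ¬ n.Prime}

lemma norm_bFun (δ θ : ℝ) : ‖bFun δ θ‖ = 1 := by
  unfold bFun
  simp only
  split_ifs
  · rw [norm_mul, Complex.norm_I, one_mul, Complex.norm_exp]
    simp
  · rw [norm_neg, Complex.norm_exp, Real.exp_eq_one_iff]
    generalize (1 - (2 * δ)⁻¹ : ℝ) = c
    simp

lemma exists_eq_sq_mul_cube {n : ℕ} (hn : n ∈ properPrimePowers) :
    ∃ x : ℕ × ℕ, n = x.1 ^ 2 * x.2 ^ 3 := by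
  obtain ⟨hpow, hnp⟩ := hn
  obtain ⟨p, j, hp, hj, rfl⟩ := (isPrimePow_nat_iff n).1 hpow
  have hj1 : j ≠ 1 := by
    rintro rfl
    exact hnp (by simpa using hp)
  rcases Nat.even_or_odd' j with ⟨i, rfl | rfl⟩
  · exact ⟨(p ^ i, 1), by simp only [one_pow, mul_one, ← pow_mul]; congr 1; ring⟩
  · obtain ⟨l, rfl⟩ : ∃ l, i = l + 1 := ⟨i - 1, by omega⟩
    exact ⟨(p ^ l, p), by ring⟩

lemma summable_properPrimePowers_rpow {σ : ℝ} (hσ : 1 / 2 < σ) :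
    Summable (properPrimePowers.indicator fun n : ℕ => (n : ℝ) ^ (-σ)) := by
  rw [← summable_subtype_iff_indicator]
  have hsum (d : ℕ) (hd : 2 ≤ d) : Summable fun m : ℕ => (m : ℝ) ^ (d * -σ) := by
    rw [Real.summable_nat_rpow]
    have : (2 : ℝ) ≤ d := by exact_mod_cast hd
    nlinarith
  have hprod := (hsum 2 le_rfl).mul_of_nonneg (hsum 3 (by norm_num))
    (fun m => by positivity) (fun m => by positivity)
  choose φ hφ using fun n : properPrimePowers => exists_eq_sq_mul_cube n.2
  have hinj : Function.Injective φ := fun m n h => Subtype.ext (by rw [hφ m, hφ n, h])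
  refine (hprod.comp_injective hinj).congr fun n => ?_
  simp only [Function.comp_apply]
  rw [hφ n, Nat.cast_mul, Nat.cast_pow, Nat.cast_pow, Real.mul_rpow (by positivity) (by positivity),
    ← Real.rpow_natCast_mul (by positivity), ← Real.rpow_natCast_mul (by positivity)]

lemma norm_logGtilde_term_le {k : ℝ} (hk : 0 < k) {Λf : ℕ → ℂ}
    (hΛ : ∀ n : ℕ, ‖Λf n‖ ≤ k * ArithmeticFunction.vonMangoldt n) {δ : ℝ}
    {a : ℕ → ℂ} (ha1 : a 1 = 1) (hamul : ∀ m n : ℕ, a (m * n) = a m * a n)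
    (hap : ∀ p : ℕ, p.Prime → a p = bFun δ (Real.log p / (2 * Real.pi)))
    {σ : ℝ} {s : ℂ} (hs : σ ≤ s.re) (n : ℕ) :
    ‖Λf n / ((Real.log n : ℂ) * (n : ℂ) ^ s) *
        (a n - bFun δ (Real.log n / (2 * Real.pi)))‖ ≤
      k * 2 * properPrimePowers.indicator (fun n : ℕ => (n : ℝ) ^ (-σ)) n := by
  by_cases hpow : IsPrimePow n
  swap
  · have : Λf n = 0 := by
      simpa [ArithmeticFunction.vonMangoldt_eq_zero_iff.2 hpow] using hΛ n
    simp [this, properPrimePowers, hpow]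
  by_cases hp : n.Prime
  · simp [hap n hp, properPrimePowers, hp]
  rw [Set.indicator_of_mem (show n ∈ properPrimePowers from ⟨hpow, hp⟩)]
  have hn : 1 < n := hpow.one_lt
  have hlog : 0 < Real.log n := Real.log_pos (by exact_mod_cast hn)
  have ha : ‖a n‖ = 1 := by
    obtain ⟨p, j, hprime, -, rfl⟩ := (isPrimePow_nat_iff n).1 hpow
    have hpj : ∀ i : ℕ, ‖a (p ^ i)‖ = 1 := fun i => by
      induction i with
      | zero => simp [ha1]
      | succ i ih => rw [pow_succ, hamul, norm_mul, ih, hap p hprime, norm_bFun, one_mul]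
    exact hpj j
  have hdiff : ‖a n - bFun δ (Real.log n / (2 * Real.pi))‖ ≤ 2 := by
    refine (norm_sub_le _ _).trans ?_
    rw [ha, norm_bFun]
    norm_num
  have hcoeff : ‖Λf n‖ / Real.log n ≤ k := by
    rw [div_le_iff₀ hlog]
    exact (hΛ n).trans (mul_le_mul_of_nonneg_left ArithmeticFunction.vonMangoldt_le_log hk.le)
  have hrpow : (n : ℝ) ^ (-s.re) ≤ (n : ℝ) ^ (-σ) :=
    Real.rpow_le_rpow_of_exponent_le (by exact_mod_cast hn.le) (neg_le_neg hs)
  calc _ = ‖Λf n‖ / Real.log n * (n : ℝ) ^ (-s.re) *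
        ‖a n - bFun δ (Real.log n / (2 * Real.pi))‖ := by
        rw [norm_mul, norm_div, norm_mul, Complex.norm_real, Real.norm_of_nonneg hlog.le,
          Complex.norm_natCast_cpow_of_pos (by omega), Real.rpow_neg (by positivity),
          ← div_div, div_eq_mul_inv _ ((n : ℝ) ^ s.re)]
    _ ≤ k * (n : ℝ) ^ (-σ) * 2 := by gcongr
    _ = _ := by ring

/-- Let `k > 0`, `f ∈ C_k` (with witness `Λ_f`), `0 ≤ δ ≤ 1/2`, and let `a`
be the completely multiplicative function determined by `a(p) = b_δ((log p)/(2π))` on primes.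
Then the series `log G̃(s) = Σ_{n ≥ 2} (Λ_f(n)/((log n) n^s)) (a(n) - b_δ((log n)/(2π)))`
converges absolutely, uniformly in the half-plane `Re s ≥ 3/4`, and defines an analytic
function in the half-plane `Re s > 1/2`. -/
theorem logGtilde_convergent_analytic (k : ℝ) (hk : 0 < k) (f Λf : ℕ → ℂ)
    (hf : MemCkWith k f Λf) (δ : ℝ) (h0 : 0 ≤ δ) (h1 : δ ≤ 1 / 2)
    (a : ℕ → ℂ) (ha1 : a 1 = 1) (hamul : ∀ m n : ℕ, a (m * n) = a m * a n)
    (hap : ∀ p : ℕ, p.Prime → a p = bFun δ (Real.log p / (2 * Real.pi))) :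
    (∃ C : ℝ, ∀ s : ℂ, 3 / 4 ≤ s.re →
      Summable (fun n : ℕ =>
        ‖Λf n / ((Real.log n : ℂ) * (n : ℂ) ^ s) *
          (a n - bFun δ (Real.log n / (2 * Real.pi)))‖) ∧
      (∑' n : ℕ, ‖Λf n / ((Real.log n : ℂ) * (n : ℂ) ^ s) *
          (a n - bFun δ (Real.log n / (2 * Real.pi)))‖) ≤ C) ∧
    DifferentiableOn ℂ
      (fun s : ℂ => ∑' n : ℕ, Λf n / ((Real.log n : ℂ) * (n : ℂ) ^ s) *
        (a n - bFun δ (Real.log n / (2 * Real.pi))))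
      {s : ℂ | 1 / 2 < s.re} := by
  have hbound {σ : ℝ} {s : ℂ} (hs : σ ≤ s.re) :=
    norm_logGtilde_term_le hk hf.2.1 ha1 hamul hap hs
  have hsum {σ : ℝ} (hσ : 1 / 2 < σ) := (summable_properPrimePowers_rpow hσ).mul_left (k * 2)
  constructor
  · have hmaj := hsum (σ := 3 / 4) (by norm_num)
    refine ⟨∑' n, k * 2 * properPrimePowers.indicator (fun n : ℕ => (n : ℝ) ^ (-(3 / 4) : ℝ)) n,
      fun s hs => ?_⟩
    have hterm := Summable.of_nonneg_of_le (fun n => norm_nonneg _) (hbound hs) hmaj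
    exact ⟨hterm, hterm.tsum_le_tsum (hbound hs) hmaj⟩
  · intro s hs
    have hs' : 1 / 2 < s.re := hs
    obtain ⟨σ, hσ, hσs⟩ := exists_between hs'
    have hopen : IsOpen {z : ℂ | σ < z.re} := isOpen_lt continuous_const Complex.continuous_re
    refine ((Complex.differentiableOn_tsum_of_summable_norm (hsum hσ) (fun n => ?_) hopen
      fun n z hz => hbound (le_of_lt hz) n).differentiableAt
        (hopen.mem_nhds hσs)).differentiableWithinAt
    intro z _
    by_cases hn : 1 < n
    · have hn0 : (n : ℂ) ≠ 0 := by exact_mod_cast (by omega : n ≠ 0)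
      have hlog : (Real.log n : ℂ) ≠ 0 := by
        exact_mod_cast (Real.log_pos (by exact_mod_cast hn)).ne'
      refine DifferentiableAt.differentiableWithinAt (DifferentiableAt.mul_const ?_ _)
      refine (differentiableAt_const _).div
        ((differentiableAt_id.const_cpow (Or.inl hn0)).const_mul _) ?_
      exact mul_ne_zero hlog (by simp [Complex.cpow_eq_zero_iff, hn0])
    · have : Real.log n = 0 := by
        interval_cases n <;> simp
      simpa [this] using differentiableWithinAt_const (0 : ℂ)
end

section
/- Let x > 0 with x ≠ 1, let τ be a real number, and let 0 < K < T. Then |(1/(2πi)) ∫_{τ+iK}^{τ+iT} x^w / w dw| ≪ x^τ / (K |log x|), with an absolute implied constant (uniform in τ, K, T, x). -/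
open Complex in
/-- The distance from `0` to a point is at least its imaginary part. -/
lemma le_norm_add_mul_I (τ t : ℝ) : t ≤ ‖(τ : ℂ) + t * I‖ := by
  have h := Complex.abs_im_le_norm ((τ : ℂ) + t * I)
  simp only [add_im, ofReal_im, mul_im, ofReal_re, I_im, mul_one, I_re, mul_zero, add_zero,
    zero_add] at h
  exact (le_abs_self t).trans h

/-- The integral of `c / t ^ 2` over an interval of positive reals. -/
lemma integral_const_div_sq {K T : ℝ} (c : ℝ) (hK : 0 < K) (hKT : K ≤ T) :
    IntervalIntegrable (fun t : ℝ => c / t ^ 2) MeasureTheory.volume K T ∧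
      ∫ t in K..T, c / t ^ 2 = c / K - c / T := by
  have hpos : ∀ t ∈ Set.uIcc K T, t ≠ 0 := fun t ht => by
    rw [Set.uIcc_of_le hKT] at ht
    exact (hK.trans_le ht.1).ne'
  have hint : IntervalIntegrable (fun t : ℝ => c / t ^ 2) MeasureTheory.volume K T :=
    (continuousOn_const.div (by fun_prop) fun t ht => pow_ne_zero 2 (hpos t ht)).intervalIntegrable
  refine ⟨hint, ?_⟩
  rw [intervalIntegral.integral_eq_sub_of_hasDerivAt (f := fun t => -c * t⁻¹) _ hint]
  · ring
  · intro t ht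
    refine ((hasDerivAt_inv (hpos t ht)).const_mul (-c)).congr_deriv ?_
    ring

open Complex in
/-- Integration by parts bounds the integral of `x ^ w / w` along a vertical segment. -/
lemma norm_integral_cpow_div_le {x τ K T : ℝ} (hx : 0 < x) (hx1 : x ≠ 1) (hK : 0 < K)
    (hKT : K ≤ T) :
    ‖∫ t in K..T, (x : ℂ) ^ ((τ : ℂ) + t * I) / ((τ : ℂ) + t * I) * I‖ ≤
      2 * (x ^ τ / |Real.log x|) / K := by
  have hL : Real.log x ≠ 0 := Real.log_ne_zero_of_pos_of_ne_one hx hx1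
  have hLC : Complex.log x ≠ 0 := by
    rw [← ofReal_log hx.le]
    exact_mod_cast hL
  have hxC : (x : ℂ) ≠ 0 := by exact_mod_cast hx.ne'
  set A : ℝ := x ^ τ / |Real.log x| with hA
  have hA0 : 0 ≤ A := by positivity
  set s : ℝ → ℂ := fun t => (τ : ℂ) + t * I with hs
  have hs_norm : ∀ t, t ≤ ‖s t‖ := le_norm_add_mul_I τ
  have hs_ne : ∀ t, 0 < t → s t ≠ 0 := fun t ht => norm_pos_iff.1 (ht.trans_le (hs_norm t))
  have hs_deriv : ∀ t, HasDerivAt s I t := fun t => by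
    refine (((hasDerivAt_id t).ofReal_comp.mul_const I).const_add (τ : ℂ)).congr_deriv ?_
    simp
  have hs_cont : Continuous s := by fun_prop
  have hpos : ∀ t ∈ Set.uIcc K T, 0 < t := fun t ht => by
    rw [Set.uIcc_of_le hKT] at ht
    exact hK.trans_le ht.1
  set v : ℝ → ℂ := fun t => (x : ℂ) ^ s t / Complex.log x with hv
  have hv_norm : ∀ t, ‖v t‖ = A := fun t => by
    rw [hv, hA, norm_div, norm_cpow_eq_rpow_re_of_pos hx, ← ofReal_log hx.le, norm_real,
      Real.norm_eq_abs]
    simp [hs]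
  have hv_deriv : ∀ t, HasDerivAt v ((x : ℂ) ^ s t * I) t := fun t => by
    refine ((((hasDerivAt_id (s t)).const_cpow (Or.inl hxC)).comp t (hs_deriv t)).div_const
      (Complex.log x)).congr_deriv ?_
    simp only [id]
    field_simp
  have hu_deriv : ∀ t ∈ Set.uIcc K T, HasDerivAt (fun t => (s t)⁻¹) (-I / s t ^ 2) t :=
    fun t ht => (hs_deriv t).fun_inv (hs_ne t (hpos t ht))
  have hparts := intervalIntegral.integral_mul_deriv_eq_deriv_mul hu_deriv
    (fun t _ => hv_deriv t)
    (ContinuousOn.intervalIntegrable (continuousOn_const.div (by fun_prop)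
      fun t ht => pow_ne_zero 2 (hs_ne t (hpos t ht))))
    (((hs_cont.const_cpow (Or.inl hxC)).mul continuous_const).intervalIntegrable K T)
  have hcongr : ∫ t in K..T, (x : ℂ) ^ s t / s t * I =
      ∫ t in K..T, (s t)⁻¹ * ((x : ℂ) ^ s t * I) :=
    intervalIntegral.integral_congr fun t _ => by ring
  have hbdry : ∀ t, 0 < t → ‖(s t)⁻¹ * v t‖ ≤ A / t := fun t ht => by
    rw [norm_mul, norm_inv, hv_norm, inv_mul_eq_div]
    exact div_le_div_of_nonneg_left hA0 ht (hs_norm t)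
  obtain ⟨hint, hval⟩ := integral_const_div_sq A hK hKT
  have hrem : ‖∫ t in K..T, -I / s t ^ 2 * v t‖ ≤ A / K - A / T := by
    rw [← hval]
    refine intervalIntegral.norm_integral_le_of_norm_le hKT (.of_forall fun t ht => ?_) hint
    have ht0 : 0 < t := hK.trans ht.1
    rw [norm_mul, norm_div, norm_neg, norm_I, norm_pow, hv_norm, one_div, inv_mul_eq_div]
    exact div_le_div_of_nonneg_left hA0 (by positivity)
      (pow_le_pow_left₀ ht0.le (hs_norm t) 2)
  rw [hcongr, hparts]
  calc _ ≤ ‖(s T)⁻¹ * v T‖ + ‖(s K)⁻¹ * v K‖ + ‖∫ t in K..T, -I / s t ^ 2 * v t‖ :=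
        (norm_sub_le _ _).trans (by gcongr; exact norm_sub_le _ _)
    _ ≤ A / T + A / K + (A / K - A / T) := by
        gcongr
        exacts [hbdry T (hK.trans_le hKT), hbdry K hK]
    _ = 2 * A / K := by ring


/-- For `x > 0`, `x ≠ 1`, `τ ∈ ℝ` and `0 < K < T`, the vertical line
integral satisfies `|(1/(2πi)) ∫_{τ+iK}^{τ+iT} x^w/w dw| ≪ x^τ/(K |log x|)`, with an absolute
implied constant (uniform in `τ`, `K`, `T`, `x`). -/
theorem vertical_segment_bound :
    ∃ C : ℝ, 0 < C ∧ ∀ x τ K T : ℝ, 0 < x → x ≠ 1 → 0 < K → K < T →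
      ‖(2 * Real.pi * Complex.I)⁻¹ *
          ∫ t in K..T,
            (x : ℂ) ^ ((τ : ℂ) + t * Complex.I) / ((τ : ℂ) + t * Complex.I) * Complex.I‖
        ≤ C * x ^ τ / (K * |Real.log x|) := by
  refine ⟨1, one_pos, fun x τ K T hx hx1 hK hKT => ?_⟩
  have hconst : ‖(2 * Real.pi * Complex.I : ℂ)⁻¹‖ ≤ 2⁻¹ := by
    rw [norm_inv]
    simp only [norm_mul, Complex.norm_I, mul_one, Complex.norm_real, Complex.norm_ofNat,
      Real.norm_eq_abs, abs_of_pos Real.pi_pos]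
    exact inv_anti₀ two_pos (by linarith [Real.pi_gt_three])
  rw [norm_mul]
  calc _ ≤ 2⁻¹ * (2 * (x ^ τ / |Real.log x|) / K) := by
        gcongr
        exact norm_integral_cpow_div_le hx hx1 hK hKT.le
    _ = 1 * x ^ τ / (K * |Real.log x|) := by
        rw [mul_comm K, ← div_div]
        ring
end

section
/- Let k > 0 and f ∈ C_k. Then |f(n)| ≤ d_k(n) for every positive integer n, where d_k is the multiplicative function defined on prime powers by d_k(p^m) = binom(k+m−1, m) (generalized binomial coefficient). -/
/-- The generalized binomial coefficient `binom (k + a - 1) a = k(k+1)⋯(k+a-1)/a!`. -/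
noncomputable def genBinom (k : ℝ) (a : ℕ) : ℝ :=
  (∏ i ∈ Finset.range a, (k + (i : ℝ))) / (a.factorial : ℝ)

/-- The generalized divisor function `d_k`, multiplicative with
`d_k(p^m) = binom (k+m-1) m` on prime powers. -/
noncomputable def dk (k : ℝ) (n : ℕ) : ℝ :=
  if n = 0 then 0 else n.factorization.prod fun _ a => genBinom k a

/-- Comparing coefficients in `-F' = F * (-F'/F)`: `f(n) log n = (f ⍟ Λ_f)(n)`. -/
theorem MemCkWith.logMul_eq_convolution {k : ℝ} {f Λf : ℕ → ℂ} (h : MemCkWith k f Λf)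
    {n : ℕ} (hn : n ≠ 0) : LSeries.logMul f n = LSeries.convolution f Λf n := by
  obtain ⟨-, -, hf, -, hΛ, -, hderiv⟩ := h
  have hf' (s : ℂ) (hs : 1 < s.re) : LSeriesSummable f s := (hf s hs).of_norm
  have hΛ' (s : ℂ) (hs : 1 < s.re) : LSeriesSummable Λf s := (hΛ s hs).of_norm
  have ha : LSeries.abscissaOfAbsConv f ≤ (1 : ℝ) :=
    LSeries.abscissaOfAbsConv_le_of_forall_lt_LSeriesSummable fun y hy => hf' y (by simpa using hy)
  have hb : LSeries.abscissaOfAbsConv Λf ≤ (1 : ℝ) :=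
    LSeries.abscissaOfAbsConv_le_of_forall_lt_LSeriesSummable fun y hy => hΛ' y (by simpa using hy)
  refine LSeries.eq_of_LSeries_eventually_eq ?_ ?_ ?_ hn
  · rw [LSeries.abscissaOfAbsConv_logMul]
    exact ha.trans_lt (EReal.coe_lt_top _)
  · exact (LSeries.abscissaOfAbsConv_convolution_le f Λf).trans_lt
      ((max_le ha hb).trans_lt (EReal.coe_lt_top _))
  · filter_upwards [Filter.eventually_gt_atTop (1 : ℝ)] with x hx
    have hx' : 1 < (x : ℂ).re := by simpa using hx
    rw [LSeries_convolution' (hf' x hx') (hΛ' x hx')]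
    have hlt : LSeries.abscissaOfAbsConv f < (x : ℂ).re :=
      ha.trans_lt (EReal.coe_lt_coe_iff.mpr hx')
    exact neg_injective ((LSeries_hasDerivAt hlt).unique (hderiv x hx'))

theorem genBinom_succ (k : ℝ) (m : ℕ) :
    ((m : ℝ) + 1) * genBinom k (m + 1) = (k + m) * genBinom k m := by
  have h : (m.factorial : ℝ) ≠ 0 := by positivity
  have h' : (m : ℝ) + 1 ≠ 0 := by positivity
  simp only [genBinom, Finset.prod_range_succ, Nat.factorial_succ]
  push_cast
  field_simp

theorem mul_genBinom_eq_sum (k : ℝ) (m : ℕ) :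
    (m : ℝ) * genBinom k m = k * ∑ i ∈ Finset.range m, genBinom k i := by
  induction m with
  | zero => simp
  | succ m ih =>
    rw [Finset.sum_range_succ, mul_add, ← ih]
    push_cast
    rw [genBinom_succ]
    ring

/-- The recursive bound on prime powers coming from `f(n) log n = (f ⍟ Λ_f)(n)`. -/
theorem MemCkWith.mul_norm_prime_pow_le {k : ℝ} {f Λf : ℕ → ℂ} (h : MemCkWith k f Λf)
    {p : ℕ} (hp : p.Prime) (m : ℕ) :
    (m : ℝ) * ‖f (p ^ m)‖ ≤ k * ∑ i ∈ Finset.range m, ‖f (p ^ i)‖ := by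
  have hlog : 0 < Real.log p := Real.log_pos (by exact_mod_cast hp.one_lt)
  have hΛ := h.2.1
  have hΛ_one : Λf 1 = 0 := by simpa using hΛ 1
  have hconv := h.logMul_eq_convolution (pow_ne_zero m hp.ne_zero)
  simp only [LSeries.convolution_def, LSeries.logMul] at hconv
  rw [Nat.sum_divisorsAntidiagonal (fun a b => f a * Λf b), Nat.sum_divisors_prime_pow hp,
    Finset.sum_range_succ, Nat.div_self (pow_pos hp.pos m), hΛ_one, mul_zero, add_zero] at hconv
  have hnorm : ‖Complex.log ((p ^ m : ℕ) : ℂ)‖ = m * Real.log p := by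
    rw [← Complex.natCast_log, Nat.cast_pow, Real.log_pow, Complex.norm_real, Real.norm_of_nonneg]
    positivity
  refine le_of_mul_le_mul_right ?_ hlog
  calc (m : ℝ) * ‖f (p ^ m)‖ * Real.log p
      = ‖Complex.log ((p ^ m : ℕ) : ℂ) * f (p ^ m)‖ := by rw [norm_mul, hnorm]; ring
    _ ≤ ∑ i ∈ Finset.range m, ‖f (p ^ i) * Λf (p ^ m / p ^ i)‖ := by
      rw [hconv]
      exact norm_sum_le _ _
    _ ≤ ∑ i ∈ Finset.range m, ‖f (p ^ i)‖ * (k * Real.log p) := by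
      refine Finset.sum_le_sum fun i hi => ?_
      have him : i < m := Finset.mem_range.mp hi
      rw [norm_mul, Nat.pow_div him.le hp.pos]
      refine mul_le_mul_of_nonneg_left ((hΛ _).trans_eq ?_) (norm_nonneg _)
      rw [ArithmeticFunction.vonMangoldt_apply_pow (Nat.sub_ne_zero_of_lt him),
        ArithmeticFunction.vonMangoldt_apply_prime hp]
    _ = k * (∑ i ∈ Finset.range m, ‖f (p ^ i)‖) * Real.log p := by
      rw [← Finset.sum_mul]
      ring

theorem MemCkWith.norm_prime_pow_le {k : ℝ} (hk : 0 ≤ k) {f Λf : ℕ → ℂ} (h : MemCkWith k f Λf)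
    {p : ℕ} (hp : p.Prime) (m : ℕ) : ‖f (p ^ m)‖ ≤ genBinom k m := by
  induction m using Nat.strong_induction_on with
  | _ m ih =>
    rcases Nat.eq_zero_or_pos m with rfl | hm
    · simp [h.1.1, genBinom]
    · have hm' : (0 : ℝ) < m := by exact_mod_cast hm
      refine le_of_mul_le_mul_left ((h.mul_norm_prime_pow_le hp m).trans ?_) hm'
      rw [mul_genBinom_eq_sum]
      exact mul_le_mul_of_nonneg_left
        (Finset.sum_le_sum fun i hi => ih i (Finset.mem_range.mp hi)) hk

/-- Let `k > 0` and `f ∈ C_k`. Then `|f(n)| ≤ d_k(n)` for every positive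
integer `n`, where `d_k` is the generalized divisor function with
`d_k(p^m) = binom (k+m-1) m` on prime powers. -/
theorem memCk_abs_le_dk (k : ℝ) (hk : 0 < k) (f : ℕ → ℂ) (hf : MemCk k f) :
    ∀ n : ℕ, 0 < n → ‖f n‖ ≤ dk k n := by
  obtain ⟨Λf, h⟩ := hf
  intro n hn
  rw [dk, if_neg hn.ne', Nat.multiplicative_factorization f h.1.2 h.1.1 hn.ne',
    Finsupp.prod, Finsupp.prod, norm_prod]
  exact Finset.prod_le_prod (fun _ _ => norm_nonneg _) fun p hp =>
    h.norm_prime_pow_le hk.le (Nat.prime_of_mem_primeFactors hp) _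
end
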